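/- arXiv:2507.23338 — 2 statements merged into one kernel-verified Lean document; each statement's English description precedes it below -/
import Mathlib

section
/- Let k and ℓ be positive integers and L a totally real number field of degree ℓ. Then there exists a real constant C = C(L,k), depending only on L and k, such that for every totally real number field K of degree k satisfying (i) disc_K > C, (ii) disc_K is coprime to disc_L, (iii) K has no subfields other than ℚ and K itself, and (iv) K/ℚ is not Galois or k does not divide ℓ, the compositum KL satisfies m(KL) ≥ m(L). -/
open scoped NumberField

def TotallyPositive (F : Type*) [Field F] (x : F) : Prop :=
  ∀ φ : F →+* ℝ, 0 < φ x

def IsTotallyRealField (F : Type*) [Field F] : Prop :=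
  ∀ φ : F →+* ℂ, ∀ x : F, (φ x).im = 0

def IsTotPosLattice (F : Type*) [Field F] (r : ℕ)
    (Λ : Submodule (𝓞 F) (Fin r → F)) (Q : QuadraticForm F (Fin r → F)) : Prop :=
  Λ.FG ∧ Submodule.span F (Λ : Set (Fin r → F)) = ⊤ ∧
    (∀ v ∈ Λ, ∃ a : 𝓞 F, (a : F) = Q v) ∧
    (∀ v : Fin r → F, v ≠ 0 → TotallyPositive F (Q v))

def IsUniversalLattice (F : Type*) [Field F] (r : ℕ)
    (Λ : Submodule (𝓞 F) (Fin r → F)) (Q : QuadraticForm F (Fin r → F)) : Prop :=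
  IsTotPosLattice F r Λ Q ∧
    ∀ a : 𝓞 F, TotallyPositive F (a : F) → ∃ v ∈ Λ, Q v = (a : F)

noncomputable def minUnivRank (F : Type*) [Field F] : ℕ :=
  sInf { r | ∃ Λ Q, IsUniversalLattice F r Λ Q }

open IntermediateField in
/-- Two ring homomorphisms between rings of integers agreeing modulo a prime at which the source is
unramified are equal. -/
theorem RingOfIntegers.hom_eq_of_forall_sub_mem {K N : Type*} [Field K] [NumberField K] [Field N]
    [NumberField N] (f g : 𝓞 K →+* 𝓞 N) (P : Ideal (𝓞 N)) [P.IsPrime]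
    [Algebra.IsUnramifiedAt ℤ (P.comap f)] (h : ∀ x, f x - g x ∈ P) : f = g := by
  have hcomap : P.comap f = P.comap g := by
    ext x
    simp only [Ideal.mem_comap]
    constructor
    · intro hx
      simpa using P.sub_mem hx (h x)
    · intro hx
      simpa using P.add_mem (h x) hx
  let B := Localization.AtPrime P
  let A := Localization.AtPrime (P.comap f)
  let F : A →+* B := Localization.localRingHom (P.comap f) P f rfl
  let G : A →+* B := Localization.localRingHom (P.comap f) P g hcomap
  have : Algebra.FormallyUnramified ℤ A := inferInstanceAs (Algebra.IsUnramifiedAt ℤ (P.comap f))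
  let F' : A →ₐ[ℤ] B := { F with commutes' := fun n => by simp }
  let G' : A →ₐ[ℤ] B := { G with commutes' := fun n => by simp }
  have hFG : F' = G' := by
    refine Algebra.FormallyUnramified.ext_of_iInf (R := ℤ) (A := A) (IsLocalRing.maximalIdeal B)
      (Ideal.iInf_pow_eq_bot_of_isLocalRing _ (Ideal.IsPrime.ne_top inferInstance)) ?_
    intro x
    have : ((Ideal.Quotient.mk (IsLocalRing.maximalIdeal B)).comp F) =
        ((Ideal.Quotient.mk (IsLocalRing.maximalIdeal B)).comp G) := by
      refine IsLocalization.ringHom_ext (P.comap f).primeCompl ?_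
      ext y
      have hF : F (algebraMap (𝓞 K) A y) = algebraMap (𝓞 N) B (f y) :=
        Localization.localRingHom_to_map (P.comap f) P f rfl y
      have hG : G (algebraMap (𝓞 K) A y) = algebraMap (𝓞 N) B (g y) :=
        Localization.localRingHom_to_map (P.comap f) P g hcomap y
      change Ideal.Quotient.mk _ (F (algebraMap (𝓞 K) A y)) =
        Ideal.Quotient.mk _ (G (algebraMap (𝓞 K) A y))
      rw [hF, hG, Ideal.Quotient.mk_eq_mk_iff_sub_mem, ← map_sub,
        ← Localization.AtPrime.map_eq_maximalIdeal]
      exact Ideal.mem_map_of_mem _ (h y)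
    exact congrArg (fun φ => φ x) this
  ext x
  have h1 : F (algebraMap (𝓞 K) A x) = G (algebraMap (𝓞 K) A x) :=
    congrArg (fun φ => φ (algebraMap (𝓞 K) A x)) hFG
  have h2 : algebraMap (𝓞 N) B (f x) = algebraMap (𝓞 N) B (g x) := by
    rw [← Localization.localRingHom_to_map (P.comap f) P f rfl,
      ← Localization.localRingHom_to_map (P.comap f) P g hcomap]
    exact h1
  have := IsLocalization.injective B P.primeCompl_le_nonZeroDivisors h2
  rw [this]

/-- The inertia group at `P` fixes every subfield in which the prime below `P` is unramified. -/
theorem NumberField.smul_eq_of_mem_inertia {K N : Type*} [Field K] [NumberField K] [Field N]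
    [NumberField N] (τ : K →+* N) (p : ℤ) (hp : Prime p) (hpK : ¬ p ∣ NumberField.discr K)
    (P : Ideal (𝓞 N)) [P.IsPrime] [P.LiesOver (Ideal.span {p})] (σ : Gal(N/ℚ))
    (hσ : σ ∈ P.inertia Gal(N/ℚ)) (x : K) : σ (τ x) = τ x := by
  let f : 𝓞 K →+* 𝓞 N := RingOfIntegers.mapRingHom τ
  let g : 𝓞 K →+* 𝓞 N := RingOfIntegers.mapRingHom ((σ : N →+* N).comp τ)
  have hpm : (p : 𝓞 N) ∈ P := (Ideal.liesOver_span_iff Ideal.IsPrime.ne_top' hp).mp inferInstance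
  have hl : (P.comap f).LiesOver (Ideal.span {p}) := by
    refine (Ideal.liesOver_span_iff Ideal.IsPrime.ne_top' hp).mpr ?_
    simpa [Ideal.mem_comap] using hpm
  have : Algebra.IsUnramifiedAt ℤ (P.comap f) := by
    refine (NumberField.not_dvd_discr_iff_isUnramifiedIn K (𝓞 K) hp).mp hpK (P.comap f)
      inferInstance hl
  have hgf : g = f := by
    symm
    refine RingOfIntegers.hom_eq_of_forall_sub_mem f g P fun y => ?_
    have := hσ (f y)
    rw [← neg_mem_iff, neg_sub]
    exact this
  have key : ∀ y : 𝓞 K, σ (τ y) = τ y := fun y => by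
    have := congrArg (fun φ => ((φ y : 𝓞 N) : N)) hgf
    exact this
  obtain ⟨a, b, hb, rfl⟩ := IsFractionRing.div_surjective (A := 𝓞 K) x
  simp only [map_div₀, key]

/-- A prime unramified in `K` is unramified in any Galois extension of `ℚ` generated by the
conjugates of `K`. -/
theorem NumberField.not_dvd_discr_of_isGalois {K N : Type*} [Field K] [NumberField K] [Field N]
    [NumberField N] [IsGalois ℚ N]
    (hN : ∀ E : IntermediateField ℚ N, (∀ (τ : K →+* N) (x : K), τ x ∈ E) → E = ⊤)
    (p : ℤ) (hp : Prime p) (hpK : ¬ p ∣ NumberField.discr K) : ¬ p ∣ NumberField.discr N := by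
  rw [NumberField.not_dvd_discr_iff_forall_liesOver N (𝓞 N) hp]
  intro P hP hl
  have hin : P.inertia Gal(N/ℚ) = ⊥ := by
    rw [eq_bot_iff]
    intro σ hσ
    rw [Subgroup.mem_bot]
    have h2 := hN (IntermediateField.fixedField (Subgroup.zpowers σ)) (by
      intro τ x
      rw [IntermediateField.mem_fixedField_iff]
      intro g hg
      have : Subgroup.zpowers σ ≤ MulAction.stabilizer Gal(N/ℚ) (τ x) := by
        rw [Subgroup.zpowers_le]
        exact NumberField.smul_eq_of_mem_inertia τ p hp hpK P σ hσ x
      exact this hg)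
    ext x
    have hx : x ∈ IntermediateField.fixedField (Subgroup.zpowers σ) := h2 ▸ trivial
    rw [IntermediateField.mem_fixedField_iff] at hx
    exact hx σ (Subgroup.mem_zpowers σ)
  have : (Ideal.span {p} : Ideal ℤ).IsPrime := (Ideal.span_singleton_prime hp.ne_zero).mpr hp
  rw [← Ideal.ramificationIdx_eq_one_iff,
    ← Ideal.ramificationIdxIn_eq_ramificationIdx (Ideal.span {p}) P Gal(N/ℚ),
    ← Ideal.card_inertia_eq_ramificationIdxIn (G := Gal(N/ℚ)) (Ideal.span {p}) P, hin]
  simp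

theorem NumberField.not_dvd_discr_normalClosure {Ω : Type*} [Field Ω] [CharZero Ω]
    [Normal ℚ Ω] (K : IntermediateField ℚ Ω) [NumberField K]
    [NumberField (IntermediateField.normalClosure ℚ K Ω)] (p : ℤ) (hp : Prime p)
    (hpK : ¬ p ∣ NumberField.discr K) :
    ¬ p ∣ NumberField.discr (IntermediateField.normalClosure ℚ K Ω) := by
  let N := IntermediateField.normalClosure ℚ K Ω
  have hnorm : Normal ℚ N := normalClosure.normal ℚ K Ω
  have : IsGalois ℚ N := by
    convert (⟨⟩ : IsGalois ℚ N)
  refine NumberField.not_dvd_discr_of_isGalois (K := K) (N := N) ?_ p hp hpK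
  intro E hE
  have h2 : N ≤ (E.toSubfield.map (algebraMap N Ω)).toIntermediateField
      (fun x => by simp) := by
    refine normalClosure_le_iff.mpr ?_
    rintro τ _ ⟨y, rfl⟩
    let τ' : K →ₐ[ℚ] N :=
      (IntermediateField.inclusion (AlgHom.fieldRange_le_normalClosure τ)).comp τ.rangeRestrict
    exact ⟨τ' y, hE (τ' : K →+* N) y, rfl⟩
  rw [eq_top_iff]
  intro x _
  obtain ⟨y, hy, hyx⟩ := h2 x.2
  have : y = x := Subtype.ext hyx
  exact this ▸ hy

theorem NumberField.linearDisjoint_of_isCoprime_discr_of_normal {Ω : Type*} [Field Ω]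
    [CharZero Ω] [Normal ℚ Ω] (K L : IntermediateField ℚ Ω) [NumberField K] [NumberField L]
    (h : IsCoprime (NumberField.discr K) (NumberField.discr L)) : K.LinearDisjoint L := by
  let NK := IntermediateField.normalClosure ℚ K Ω
  let NL := IntermediateField.normalClosure ℚ L Ω
  have hK : FiniteDimensional ℚ K := by convert! NumberField.to_finiteDimensional (K := K)
  have hL : FiniteDimensional ℚ L := by convert! NumberField.to_finiteDimensional (K := L)
  have hfK : FiniteDimensional ℚ NK := normalClosure.is_finiteDimensional ℚ K Ω
  have hfL : FiniteDimensional ℚ NL := normalClosure.is_finiteDimensional ℚ L Ω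
  have : NumberField NK := { to_finiteDimensional := by convert! hfK }
  have : NumberField NL := { to_finiteDimensional := by convert! hfL }
  have hnK : Normal ℚ NK := normalClosure.normal ℚ K Ω
  have : @IsGalois ℚ _ NK _ NK.algebra' := { }
  refine IntermediateField.LinearDisjoint.of_le (A := NK) (B := NL) ?_
    (IntermediateField.le_normalClosure K) (IntermediateField.le_normalClosure L)
  apply IntermediateField.LinearDisjoint.of_inf_eq_bot
  let M : IntermediateField ℚ Ω := NK ⊓ NL
  have hfM : FiniteDimensional ℚ M := .of_injective
    (IntermediateField.inclusion (inf_le_left : M ≤ NK)).toLinearMap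
    (IntermediateField.inclusion (inf_le_left : M ≤ NK)).injective
  have : NumberField M := { to_finiteDimensional := by convert! hfM }
  let : Algebra M NK := (IntermediateField.inclusion (inf_le_left : M ≤ NK)).toAlgebra
  let : Algebra M NL := (IntermediateField.inclusion (inf_le_right : M ≤ NL)).toAlgebra
  change M = ⊥
  by_contra hM
  have h1 : 1 < Module.finrank ℚ M := by
    refine Nat.one_lt_iff_ne_zero_and_ne_one.mpr ⟨Module.finrank_pos.ne', ?_⟩
    rw [← IntermediateField.finrank_eq_one_iff] at hM
    convert! hM
  have h2 := NumberField.abs_discr_gt_two h1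
  obtain ⟨p, hp, hpM⟩ := (NumberField.discr M).exists_prime_and_dvd (by
    rw [Int.abs_eq_natAbs] at h2
    omega)
  have hK : p ∣ NumberField.discr K := by
    by_contra hc
    exact NumberField.not_dvd_discr_normalClosure K p hp hc
      (hpM.trans (NumberField.discr_dvd_discr M NK))
  have hL : p ∣ NumberField.discr L := by
    by_contra hc
    exact NumberField.not_dvd_discr_normalClosure L p hp hc
      (hpM.trans (NumberField.discr_dvd_discr M NL))
  exact hp.not_isUnit (h.isUnit_of_dvd' hK hL)

/-- Number fields with coprime discriminants are linearly disjoint. -/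
theorem NumberField.linearDisjoint_of_isCoprime_discr {E : Type*} [Field E]
    [CharZero E] (K L : IntermediateField ℚ E) [NumberField K] [NumberField L]
    (h : IsCoprime (NumberField.discr K) (NumberField.discr L)) : K.LinearDisjoint L := by
  have hK : FiniteDimensional ℚ K := by convert! NumberField.to_finiteDimensional (K := K)
  have hL : FiniteDimensional ℚ L := by convert! NumberField.to_finiteDimensional (K := L)
  let Ω := AlgebraicClosure ℚ
  have : FiniteDimensional ℚ ↥(K ⊔ L) := IntermediateField.finiteDimensional_sup K L
  have : Algebra.IsAlgebraic ℚ ↥(K ⊔ L) := Algebra.IsAlgebraic.of_finite ℚ _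
  have hc : CharZero Ω := charZero_of_injective_algebraMap (algebraMap ℚ Ω).injective
  have hn : @Normal ℚ Ω _ _ DivisionRing.toRatAlgebra := by
    have := @IsAlgClosure.normal ℚ (AlgebraicClosure ℚ) _ _ (AlgebraicClosure.instAlgebra ℚ)
      (AlgebraicClosure.instIsAlgClosure ℚ)
    convert! this
  let f : ↥(K ⊔ L) →ₐ[ℚ] Ω := IsAlgClosed.lift
  let fK : K →ₐ[ℚ] Ω := f.comp (IntermediateField.inclusion le_sup_left)
  let fL : L →ₐ[ℚ] Ω := f.comp (IntermediateField.inclusion le_sup_right)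
  let eK : K ≃ₐ[ℚ] fK.fieldRange := AlgEquiv.ofInjectiveField fK
  let eL : L ≃ₐ[ℚ] fL.fieldRange := AlgEquiv.ofInjectiveField fL
  let e : ↥(K ⊔ L) ≃ₐ[ℚ] f.fieldRange := AlgEquiv.ofInjectiveField f
  have h1 : FiniteDimensional ℚ fK.fieldRange := eK.toLinearEquiv.finiteDimensional
  have h2 : FiniteDimensional ℚ fL.fieldRange := eL.toLinearEquiv.finiteDimensional
  have h3 : FiniteDimensional ℚ f.fieldRange := e.toLinearEquiv.finiteDimensional
  have : NumberField fK.fieldRange := { to_finiteDimensional := by convert! h1 }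
  have : NumberField fL.fieldRange := { to_finiteDimensional := by convert! h2 }
  rw [NumberField.discr_eq_discr_of_ringEquiv K eK.toRingEquiv,
    NumberField.discr_eq_discr_of_ringEquiv L eL.toRingEquiv] at h
  have hd := NumberField.linearDisjoint_of_isCoprime_discr_of_normal _ _ h
  have hle : fK.fieldRange ⊔ fL.fieldRange ≤ f.fieldRange := by
    refine sup_le ?_ ?_
    · rintro _ ⟨x, rfl⟩
      exact ⟨_, rfl⟩
    · rintro _ ⟨x, rfl⟩
      exact ⟨_, rfl⟩
  have hfin := IntermediateField.finrank_le_of_le_right hle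
  rw [hd.finrank_sup] at hfin
  refine IntermediateField.LinearDisjoint.of_finrank_sup (le_antisymm
    (IntermediateField.finrank_sup_le K L) ?_)
  rw [eK.toLinearEquiv.finrank_eq, eL.toLinearEquiv.finrank_eq, e.toLinearEquiv.finrank_eq]
  exact hfin

open NumberField NumberField.Units NumberField.Units.dirichletUnitTheorem in
/-- Up to squares of units, the absolute values of a nonzero element of a number field at the
infinite places differ by a bounded factor. -/
theorem NumberField.Units.exists_log_sub_log_le (F : Type*) [Field F] [NumberField F] :
    ∃ R : ℝ, ∀ a : F, a ≠ 0 → ∃ ε : (𝓞 F)ˣ, ∀ w w' : InfinitePlace F,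
      Real.log (w (((ε : 𝓞 F) : F) ^ 2 * a)) - Real.log (w' (((ε : 𝓞 F) : F) ^ 2 * a)) ≤ R := by
  classical
  have : IsZLattice ℝ (unitLattice F) := ⟨unitLattice_span_eq_top F⟩
  let b := (basisUnitLattice F).ofZLatticeBasis ℝ (unitLattice F)
  let R₀ := ∑ i, ‖b i‖
  have hR₀ : 0 ≤ R₀ := Finset.sum_nonneg fun i _ => norm_nonneg _
  let c : ℝ := Fintype.card (InfinitePlace F)
  have hc : 1 ≤ c := by
    have : 0 < Fintype.card (InfinitePlace F) := Fintype.card_pos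
    exact Nat.one_le_cast.mpr this
  refine ⟨2 * (2 * R₀ * c), fun a ha => ?_⟩
  let n : ℝ := ∑ w : InfinitePlace F, (w.mult : ℝ)
  have hn : 0 < n := Finset.sum_pos (fun w _ => by exact_mod_cast InfinitePlace.mult_pos)
    Finset.univ_nonempty
  let m : ℝ := (∑ w : InfinitePlace F, (w.mult : ℝ) * Real.log (w a)) / n
  let z : logSpace F := fun w => (w.1.mult : ℝ) * (Real.log (w.1 a) - m) / 2
  have hfl : (ZSpan.floor b z : logSpace F) ∈ unitLattice F := by
    have hs := Module.Basis.ofZLatticeBasis_span ℝ (unitLattice F) (basisUnitLattice F)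
    exact hs.le (ZSpan.floor b z).2
  obtain ⟨η, -, hη⟩ := hfl
  have hfr : ‖z - logEmbedding F η‖ ≤ R₀ := by
    have := ZSpan.norm_fract_le b z
    rw [ZSpan.fract_apply] at this
    have hη' : logEmbedding F η = (ZSpan.floor b z : logSpace F) := hη
    rw [hη']
    exact this
  let η' : (𝓞 F)ˣ := η.toMul
  let y : InfinitePlace F → ℝ := fun w =>
    (w.mult : ℝ) * (Real.log (w a) - m - 2 * Real.log (w ((η' : 𝓞 F) : F)))
  have hy1 : ∀ w : InfinitePlace F, w ≠ w₀ → |y w| ≤ 2 * R₀ := by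
    intro w hw
    have h1 := (norm_le_pi_norm (z - logEmbedding F η) ⟨w, hw⟩).trans hfr
    have h2 : (z - logEmbedding F η) ⟨w, hw⟩ = y w / 2 := by
      have := logEmbedding_component η' ⟨w, hw⟩
      change z ⟨w, hw⟩ - logEmbedding F (Additive.ofMul η') ⟨w, hw⟩ = _
      rw [this]
      simp only [z, y]
      ring
    rw [h2, Real.norm_eq_abs, abs_div, abs_two] at h1
    linarith
  have hysum : ∑ w, y w = 0 := by
    have h1 := sum_mult_mul_log η'
    have h2 : ∑ w, y w = ∑ w : InfinitePlace F, (w.mult : ℝ) * Real.log (w a) - n * m -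
        2 * ∑ w : InfinitePlace F, (w.mult : ℝ) * Real.log (w ((η' : 𝓞 F) : F)) := by
      simp only [y, n, mul_sub, Finset.sum_sub_distrib, Finset.sum_mul, Finset.mul_sum]
      congr 1
      exact Finset.sum_congr rfl fun w _ => by ring
    rw [h2, h1]
    simp only [m]
    field_simp
    ring
  have hy : ∀ w, |y w| ≤ 2 * R₀ * c := by
    intro w
    by_cases hw : w = w₀
    · subst hw
      have : y w₀ = - ∑ w ∈ Finset.univ.erase w₀, y w := by
        rw [← Finset.add_sum_erase _ _ (Finset.mem_univ (w₀ : InfinitePlace F))] at hysum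
        linarith
      rw [this, abs_neg]
      refine (Finset.abs_sum_le_sum_abs _ _).trans ?_
      refine (Finset.sum_le_sum (g := fun _ => 2 * R₀) fun w hw =>
        hy1 w (Finset.ne_of_mem_erase hw)).trans ?_
      rw [Finset.sum_const, nsmul_eq_mul, mul_comm]
      refine mul_le_mul_of_nonneg_left ?_ (by positivity)
      exact Nat.cast_le.mpr (Finset.card_le_univ _)
    · refine (hy1 w hw).trans ?_
      nlinarith
  have hη0 : ((η' : 𝓞 F) : F) ≠ 0 := by simp
  have key : ∀ w : InfinitePlace F,
      |Real.log (w ((((η'⁻¹ : (𝓞 F)ˣ) : 𝓞 F) : F) ^ 2 * a)) - m| ≤ 2 * R₀ * c := by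
    intro w
    have hw0 : w ((η' : 𝓞 F) : F) ≠ 0 := by simp
    have hwa : w a ≠ 0 := by simpa using ha
    have hinv : (((η'⁻¹ : (𝓞 F)ˣ) : 𝓞 F) : F) = ((η' : 𝓞 F) : F)⁻¹ := by simp
    rw [hinv, map_mul, map_pow, map_inv₀, Real.log_mul (by positivity) hwa, Real.log_pow,
      Real.log_inv]
    have h1 : (1 : ℝ) ≤ w.mult := by exact_mod_cast InfinitePlace.mult_pos
    have h2 := hy w
    simp only [y, abs_mul, Nat.abs_cast] at h2
    refine le_trans ?_ h2
    refine le_trans (le_of_eq ?_) (le_mul_of_one_le_left (abs_nonneg _) h1)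
    congr 1
    push_cast
    ring
  refine ⟨η'⁻¹, fun w w' => ?_⟩
  have h1 := abs_le.mp (key w)
  have h2 := abs_le.mp (key w')
  linarith

theorem IsTotallyRealField.exists_real {F : Type*} [Field F] (hF : IsTotallyRealField F)
    (ψ : F →+* ℂ) : ∃ φ : F →+* ℝ, ∀ x, ψ x = φ x := by
  have h : NumberField.ComplexEmbedding.IsReal ψ := by
    ext x
    exact Complex.conj_eq_iff_im.mpr (hF ψ x)
  exact ⟨h.embedding, fun x => (h.coe_embedding_apply x).symm⟩

theorem IsTotallyRealField.nonempty_ringHom_real {F : Type*} [Field F] [NumberField F]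
    (hF : IsTotallyRealField F) : Nonempty (F →+* ℝ) :=
  let ⟨φ, _⟩ := hF.exists_real (Classical.arbitrary (F →+* ℂ))
  ⟨φ⟩

theorem IsTotallyRealField.finite_abs_le {F : Type*} [Field F] [NumberField F]
    (hF : IsTotallyRealField F) (B : ℝ) :
    {x : 𝓞 F | ∀ φ : F →+* ℝ, |φ x| ≤ B}.Finite := by
  refine Set.Finite.of_injOn (f := fun x : 𝓞 F => (x : F)) ?_
    NumberField.RingOfIntegers.coe_injective.injOn
    (NumberField.Embeddings.finite_of_norm_le F ℂ B)
  intro x hx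
  refine ⟨x.isIntegral_coe, fun ψ => ?_⟩
  obtain ⟨φ, hφ⟩ := hF.exists_real ψ
  rw [hφ]
  simpa using hx φ

theorem finite_ringHom_real (F : Type*) [Field F] [NumberField F] : Finite (F →+* ℝ) :=
  .of_injective (fun φ : F →+* ℝ => Complex.ofRealHom.comp φ) fun φ ψ h => by
    ext x
    simpa using congrArg (fun f => f x) h

theorem TotallyPositive.exists_unit_balanced (F : Type*) [Field F] [NumberField F] :
    ∃ M : ℝ, 1 ≤ M ∧ ∀ a : F, TotallyPositive F a → ∃ ε : (𝓞 F)ˣ, ∀ φ ψ : F →+* ℝ,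
      φ (((ε : 𝓞 F) : F) ^ 2 * a) ≤ M * ψ (((ε : 𝓞 F) : F) ^ 2 * a) := by
  obtain ⟨R, hR⟩ := NumberField.Units.exists_log_sub_log_le F
  refine ⟨Real.exp (max R 0), Real.one_le_exp (le_max_right _ _), fun a ha => ?_⟩
  by_cases ha0 : a = 0
  · refine ⟨1, fun φ ψ => ?_⟩
    simp [ha0]
  obtain ⟨ε, hε⟩ := hR a ha0
  refine ⟨ε, fun φ ψ => ?_⟩
  have hpos : ∀ φ : F →+* ℝ, 0 < φ (((ε : 𝓞 F) : F) ^ 2 * a) := fun φ => by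
    have h1 := ha φ
    have h2 : φ ((ε : 𝓞 F) : F) ≠ 0 := by simp
    rw [map_mul, map_pow]
    positivity
  have hw : ∀ φ : F →+* ℝ, NumberField.InfinitePlace.mk (Complex.ofRealHom.comp φ)
      (((ε : 𝓞 F) : F) ^ 2 * a) = φ (((ε : 𝓞 F) : F) ^ 2 * a) := fun φ => by
    rw [NumberField.InfinitePlace.apply]
    simp only [RingHom.comp_apply, Complex.ofRealHom_eq_coe, Complex.norm_real, Real.norm_eq_abs]
    exact abs_of_pos (hpos φ)
  have h := hε (.mk (Complex.ofRealHom.comp φ)) (.mk (Complex.ofRealHom.comp ψ))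
  rw [hw, hw, ← Real.log_div (hpos φ).ne' (hpos ψ).ne'] at h
  have h2 := (Real.log_le_iff_le_exp (div_pos (hpos φ) (hpos ψ))).mp (h.trans (le_max_left R 0))
  exact (div_le_iff₀ (hpos ψ)).mp h2

theorem NumberField.exists_sum_near (F : Type*) [Field F] [NumberField F] :
    ∃ W : ℝ, 0 < W ∧ ∀ (a : 𝓞 F) (q : ℕ), 0 < q → ∃ v : ℕ → 𝓞 F,
      ∑ t ∈ Finset.range q, v t = a ∧ ∀ t, ∀ φ : F →+* ℝ, |φ (v t) - φ a / q| ≤ W := by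
  classical
  let ω := NumberField.RingOfIntegers.basis F
  have hfin := finite_ringHom_real F
  have : Fintype (F →+* ℝ) := Fintype.ofFinite _
  refine ⟨1 + ∑ φ : F →+* ℝ, ∑ j, |φ (ω j)|, by positivity, fun a q hq => ?_⟩
  let s : _ → ℤ := fun j => ω.repr a j / q
  let c : _ → ℤ := fun j => ω.repr a j % q
  have hc0 : ∀ j, 0 ≤ c j := fun j => Int.emod_nonneg _ (by omega)
  have hcq : ∀ j, c j < q := fun j => Int.emod_lt_of_pos _ (by omega)
  have hsc : ∀ j, q * s j + c j = ω.repr a j := fun j => Int.mul_ediv_add_emod _ _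
  let v : ℕ → 𝓞 F := fun t => ∑ j, (s j + if (t : ℤ) < c j then 1 else 0) • ω j
  refine ⟨v, ?_, fun t φ => ?_⟩
  · simp only [v]
    rw [Finset.sum_comm]
    conv_rhs => rw [← ω.sum_repr a]
    refine Finset.sum_congr rfl fun j _ => ?_
    rw [← Finset.sum_smul, ← hsc j]
    congr 1
    rw [Finset.sum_add_distrib, Finset.sum_const, Finset.card_range, nsmul_eq_mul]
    congr 1
    rw [Finset.sum_ite, Finset.sum_const_zero, add_zero, Finset.sum_const, nsmul_eq_mul, mul_one]
    have : Finset.filter (fun t : ℕ => (t : ℤ) < c j) (Finset.range q) =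
        Finset.range (c j).toNat := by
      ext t
      have := hc0 j
      have := hcq j
      simp only [Finset.mem_filter, Finset.mem_range]
      omega
    rw [this, Finset.card_range]
    exact Int.toNat_of_nonneg (hc0 j)
  · have hq' : (0 : ℝ) < q := by exact_mod_cast hq
    have ha : φ a = ∑ j, ((ω.repr a j : ℤ) : ℝ) * φ (ω j) := by
      conv_lhs => rw [← ω.sum_repr a]
      simp [zsmul_eq_mul]
    have hv : φ (v t) = ∑ j, ((s j : ℝ) + if (t : ℤ) < c j then 1 else 0) * φ (ω j) := by
      simp only [v, zsmul_eq_mul, map_sum, map_mul]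
      refine Finset.sum_congr rfl fun j _ => ?_
      split_ifs <;> simp
    have hterm : ∀ j, |((s j : ℝ) + (if (t : ℤ) < c j then 1 else 0) -
        ((ω.repr a j : ℤ) : ℝ) / q) * φ (ω j)| ≤ |φ (ω j)| := by
      intro j
      rw [abs_mul]
      refine mul_le_of_le_one_left (abs_nonneg _) ?_
      have h1 : (0 : ℝ) ≤ c j := by exact_mod_cast hc0 j
      have h2 : (c j : ℝ) ≤ q := by exact_mod_cast (hcq j).le
      have h3 : (c j : ℝ) / q ≤ 1 := (div_le_one hq').mpr h2
      have h4 : (0 : ℝ) ≤ c j / q := by positivity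
      have h5 : ((ω.repr a j : ℤ) : ℝ) / q = s j + c j / q := by
        rw [← hsc j]
        push_cast
        field_simp
      rw [h5, abs_le]
      split_ifs <;> constructor <;> linarith
    rw [hv, ha, Finset.sum_div, ← Finset.sum_sub_distrib]
    refine (Finset.abs_sum_le_sum_abs _ _).trans ?_
    have h6 : ∑ j, |φ (ω j)| ≤ ∑ φ : F →+* ℝ, ∑ j, |φ (ω j)| :=
      Finset.single_le_sum (f := fun φ : F →+* ℝ => ∑ j, |φ (ω j)|)
        (fun φ _ => by positivity) (Finset.mem_univ φ)
    refine le_trans (Finset.sum_le_sum fun j _ => ?_) (h6.trans (by linarith))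
    refine le_trans (le_of_eq ?_) (hterm j)
    congr 1
    ring

theorem TotallyPositive.exists_finset_generators (F : Type*) [Field F] [NumberField F]
    (hF : IsTotallyRealField F) :
    ∃ T : Finset (𝓞 F), (∀ v ∈ T, TotallyPositive F (v : F)) ∧
      ∀ a : 𝓞 F, TotallyPositive F (a : F) → ∃ (ε : (𝓞 F)ˣ) (n : 𝓞 F → ℕ),
        (ε : 𝓞 F) ^ 2 * a = ∑ v ∈ T, n v • v := by
  classical
  obtain ⟨M, hM, hbal⟩ := TotallyPositive.exists_unit_balanced F
  obtain ⟨W, hW, hdec⟩ := NumberField.exists_sum_near F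
  let T : Finset (𝓞 F) := ((hF.finite_abs_le (4 * M ^ 2 * W + W)).toFinset).filter
    fun v : 𝓞 F => TotallyPositive F (v : F)
  have hT : ∀ v : 𝓞 F, (∀ φ : F →+* ℝ, 0 < φ v ∧ φ v ≤ 4 * M ^ 2 * W + W) → v ∈ T := by
    intro v hv
    simp only [T, Finset.mem_filter, Set.Finite.mem_toFinset, Set.mem_ofPred_eq]
    exact ⟨fun φ => (abs_of_pos (hv φ).1).trans_le (hv φ).2, fun φ => (hv φ).1⟩
  refine ⟨T, fun v hv => (Finset.mem_filter.mp hv).2, fun a ha => ?_⟩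
  obtain ⟨ε, hε⟩ := hbal a ha
  refine ⟨ε, ?_⟩
  generalize hb : (ε : 𝓞 F) ^ 2 * a = b
  have hb' : ((ε : 𝓞 F) : F) ^ 2 * (a : F) = (b : F) := by
    rw [← hb]
    simp
  rw [hb'] at hε
  have hbpos : ∀ φ : F →+* ℝ, 0 < φ b := fun φ => by
    have h1 := ha φ
    have h2 : φ ((ε : 𝓞 F) : F) ≠ 0 := by simp
    rw [← hb', map_mul, map_pow]
    positivity
  suffices h : ∃ (q : ℕ) (v : ℕ → 𝓞 F), ∑ t ∈ Finset.range q, v t = b ∧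
      ∀ t, v t ∈ T by
    obtain ⟨q, v, hsum, hv⟩ := h
    refine ⟨fun x => ((Finset.range q).filter fun t => v t = x).card, ?_⟩
    rw [← hsum]
    rw [← Finset.sum_fiberwise_of_maps_to (t := T) (g := v) fun t _ => hv t]
    refine Finset.sum_congr rfl fun x _ => ?_
    rw [Finset.sum_congr rfl (g := fun _ => x) fun t ht => (Finset.mem_filter.mp ht).2,
      Finset.sum_const]
  obtain ⟨φ₀⟩ := hF.nonempty_ringHom_real
  let μ := φ₀ b / M
  have hM0 : 0 < M := by linarith
  have hμ : 0 < μ := div_pos (hbpos φ₀) hM0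
  have hlow : ∀ φ : F →+* ℝ, μ ≤ φ b := fun φ => by
    rw [div_le_iff₀ hM0, mul_comm]
    exact hε φ₀ φ
  have hhigh : ∀ φ : F →+* ℝ, φ b ≤ M ^ 2 * μ := fun φ => by
    refine (hε φ φ₀).trans (le_of_eq ?_)
    simp only [μ]
    field_simp
  have hle := Nat.floor_le (a := μ / (2 * W)) (by positivity)
  have hlt := Nat.lt_floor_add_one (μ / (2 * W))
  rcases Nat.eq_zero_or_pos ⌊μ / (2 * W)⌋₊ with hq | hq
  · refine ⟨1, fun _ => b, by simp, fun _ => hT b fun φ => ⟨hbpos φ, (hhigh φ).trans ?_⟩⟩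
    rw [hq, Nat.cast_zero, zero_add, div_lt_one (by positivity)] at hlt
    have : M ^ 2 * μ ≤ M ^ 2 * (2 * W) := by gcongr
    nlinarith [sq_nonneg M]
  · obtain ⟨v, hsum, hv⟩ := hdec b _ hq
    refine ⟨_, v, hsum, fun t => hT _ fun φ => ?_⟩
    generalize ⌊μ / (2 * W)⌋₊ = q at *
    have hq1 : (1 : ℝ) ≤ q := Nat.one_le_cast.mpr hq
    have hq0 : (0 : ℝ) < q := by linarith
    rw [le_div_iff₀ (by positivity)] at hle
    rw [div_lt_iff₀ (by positivity)] at hlt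
    have h1 : 2 * W ≤ φ b / q := by
      rw [le_div_iff₀ hq0]
      linarith [hlow φ]
    have h2 : φ b / q ≤ 4 * M ^ 2 * W := by
      rw [div_le_iff₀ hq0]
      refine (hhigh φ).trans ?_
      have : M ^ 2 * μ ≤ M ^ 2 * (4 * W * q) := by
        gcongr
        nlinarith
      linarith
    have h3 := abs_le.mp (hv t φ)
    constructor <;> linarith

/-- Every totally real number field admits a universal quadratic lattice. -/
theorem exists_isUniversalLattice (F : Type*) [Field F] [NumberField F]
    (hF : IsTotallyRealField F) : ∃ r Λ Q, IsUniversalLattice F r Λ Q := by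
  classical
  obtain ⟨T, hT, hgen⟩ := TotallyPositive.exists_finset_generators F hF
  let e : T × Fin 4 ≃ Fin (Fintype.card (T × Fin 4)) := Fintype.equivFin _
  let w : Fin (Fintype.card (T × Fin 4)) → F := fun i => (((e.symm i).1 : 𝓞 F) : F)
  have hw : ∀ i, TotallyPositive F (w i) := fun i => hT _ (e.symm i).1.2
  let ι : (Fin (Fintype.card (T × Fin 4)) → 𝓞 F) →ₗ[𝓞 F]
      (Fin (Fintype.card (T × Fin 4)) → F) := (Algebra.linearMap (𝓞 F) F).compLeft _
  have hQ : ∀ v, QuadraticMap.weightedSumSquares F w v = ∑ i, w i * (v i * v i) := fun v => by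
    simp [QuadraticMap.weightedSumSquares_apply]
  refine ⟨_, LinearMap.range ι, QuadraticMap.weightedSumSquares F w, ⟨?_, ?_, ?_, ?_⟩, ?_⟩
  · rw [LinearMap.range_eq_map]
    exact Submodule.FG.map ι Module.Finite.fg_top
  · rw [eq_top_iff, ← (Pi.basisFun F _).span_eq, Submodule.span_le]
    rintro _ ⟨i, rfl⟩
    refine Submodule.subset_span ⟨Pi.single i 1, ?_⟩
    ext j
    by_cases h : j = i
    · subst h
      simp [ι]
    · simp [ι, h]
  · rintro _ ⟨v, rfl⟩
    refine ⟨∑ i, ((e.symm i).1 : 𝓞 F) * (v i * v i), ?_⟩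
    rw [hQ]
    simp [w, ι]
  · intro v hv φ
    rw [hQ, map_sum]
    obtain ⟨i, hi⟩ := Function.ne_iff.mp hv
    have h0 : ∀ j, 0 ≤ φ (w j * (v j * v j)) := fun j => by
      rw [map_mul, map_mul]
      exact mul_nonneg (hw j φ).le (mul_self_nonneg _)
    refine Finset.sum_pos' (fun j _ => h0 j) ⟨i, Finset.mem_univ i, ?_⟩
    rw [map_mul, map_mul]
    exact mul_pos (hw i φ) (mul_self_pos.mpr (by simpa using hi))
  · intro a ha
    obtain ⟨ε, n, hn⟩ := hgen a ha
    choose c₀ c₁ c₂ c₃ hc using fun v => Nat.sum_four_squares (n v)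
    let c : 𝓞 F → Fin 4 → ℕ := fun v => ![c₀ v, c₁ v, c₂ v, c₃ v]
    have hc' : ∀ v, ∑ j, c v j ^ 2 = n v := fun v => by
      rw [← hc v]
      simp [c, Fin.sum_univ_four]
    let x : Fin (Fintype.card (T × Fin 4)) → 𝓞 F := fun i =>
      ((ε⁻¹ : (𝓞 F)ˣ) : 𝓞 F) * c (e.symm i).1 (e.symm i).2
    refine ⟨ι x, ⟨x, rfl⟩, ?_⟩
    have hx : ∑ i, ((e.symm i).1 : 𝓞 F) * (x i * x i) = a := by
      rw [← e.sum_comp]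
      simp only [x, Equiv.symm_apply_apply]
      rw [Fintype.sum_prod_type]
      have : a = ((ε⁻¹ : (𝓞 F)ˣ) : 𝓞 F) ^ 2 * ∑ v ∈ T, n v • v := by
        rw [← hn, ← mul_assoc, ← mul_pow, Units.inv_mul, one_pow, one_mul]
      rw [this, Finset.mul_sum, ← Finset.sum_coe_sort T]
      refine Fintype.sum_congr _ _ fun v => ?_
      rw [← hc' v, nsmul_eq_mul, Nat.cast_sum, Finset.sum_mul, Finset.mul_sum]
      refine Fintype.sum_congr _ _ fun j => ?_
      push_cast
      ring
    rw [hQ, ← hx]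
    simp [w, ι]

/-- A symmetric bilinear form that is integral on a spanning family, totally positive modulo its
radical and of rank less than `m` gives a totally positive lattice of rank less than `m`. -/
theorem exists_isTotPosLattice_of_bilin {F : Type*} [Field F] [NumberField F]
    [Nonempty (F →+* ℝ)] (m : ℕ) {I V : Type*} [AddCommGroup V] [Module F V] (e : I → V)
    (he : Submodule.span F (Set.range e) = ⊤) (B : V →ₗ[F] V →ₗ[F] F)
    (hsymm : ∀ x y, B x y = B y x) (hint : ∀ a b, ∃ h : 𝓞 F, (h : F) = B (e a) (e b))
    (q : I → 𝓞 F) (hq : ∀ a, B (e a) (e a) = 2 * (q a : F))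
    (hpos : ∀ x, (∀ y, B x y = 0) ∨ TotallyPositive F (B x x))
    (hdet : ∀ x : Fin m → V, ∃ c : Fin m → F, c ≠ 0 ∧
      B (∑ i, c i • x i) (∑ i, c i • x i) = 0) :
    ∃ r < m, ∃ Λ Q, IsTotPosLattice F r Λ Q ∧ ∀ a, ∃ v ∈ Λ, Q v = (q a : F) := by
  classical
  obtain ⟨φ₀⟩ := ‹Nonempty (F →+* ℝ)›
  have hrad : ∀ x, B x x = 0 → ∀ y, B x y = 0 := fun x hx => by
    rcases hpos x with h | h
    · exact h
    · have := h φ₀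
      simp [hx] at this
  obtain ⟨W, hW⟩ := Submodule.exists_isCompl (LinearMap.ker B)
  have hWpos : ∀ x ∈ W, x ≠ 0 → TotallyPositive F (B x x) := by
    intro x hx hx0
    rcases hpos x with h | h
    · have : x ∈ LinearMap.ker B := LinearMap.mem_ker.mpr (LinearMap.ext h)
      exact absurd (Submodule.disjoint_def.mp hW.disjoint x this hx) hx0
    · exact h
  have hrank : Module.rank F W < m := by
    by_contra hc
    obtain ⟨f, hf⟩ := exists_linearIndependent_of_le_rank (not_lt.mp hc)
    obtain ⟨c, hc0, hc⟩ := hdet fun i => (f i : V)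
    refine hc0 (funext (Fintype.linearIndependent_iff.mp hf c ?_))
    by_contra hne
    have h1 : (∑ i, c i • (f i : V)) = ((∑ i, c i • f i : W) : V) := by simp
    have := hWpos _ (∑ i, c i • f i : W).2 (fun h => hne (Subtype.ext h)) φ₀
    rw [← h1, hc] at this
    simp at this
  have hfin : Module.Finite F W :=
    Module.rank_lt_aleph0_iff.mp (hrank.trans (Cardinal.natCast_lt_aleph0))
  let ε : W ≃ₗ[F] (Fin (Module.finrank F W) → F) := (Module.finBasis F W).equivFun
  let j : (Fin (Module.finrank F W) → F) →ₗ[F] V := W.subtype ∘ₗ ε.symm.toLinearMap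
  let B' : (Fin (Module.finrank F W) → F) →ₗ[F] (Fin (Module.finrank F W) → F) →ₗ[F] F :=
    B.compl₁₂ j j
  have hB' : ∀ v w, B' v w = B (j v) (j w) := fun v w => rfl
  let Q : QuadraticForm F (Fin (Module.finrank F W) → F) :=
    (2⁻¹ : F) • LinearMap.BilinMap.toQuadraticMap B'
  have hQ : ∀ v, Q v = 2⁻¹ * B' v v := fun v => rfl
  let p : V →ₗ[F] (Fin (Module.finrank F W) → F) :=
    ε.toLinearMap ∘ₗ W.projectionOnto (LinearMap.ker B) hW.symm
  have hjp : ∀ x, ∀ y, B (j (p x)) y = B x y := by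
    intro x y
    have h1 : x - j (p x) ∈ LinearMap.ker B := by
      have hj : j (p x) = (W.projectionOnto (LinearMap.ker B) hW.symm x : V) := by simp [j, p]
      rw [hj, ← Submodule.projectionOnto_apply_eq_zero_iff hW.symm, map_sub,
        Submodule.projectionOnto_apply_left, sub_self]
    have h2 : B (x - j (p x)) y = 0 := by
      rw [LinearMap.mem_ker.mp h1]
      rfl
    rw [map_sub, LinearMap.sub_apply] at h2
    exact (sub_eq_zero.mp h2).symm
  have hB'p : ∀ x y, B' (p x) (p y) = B x y := fun x y => by
    rw [hB', hjp, hsymm, hjp, hsymm]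
  let Λ : Submodule (𝓞 F) (Fin (Module.finrank F W) → F) :=
    Submodule.span (𝓞 F) (Set.range fun a => p (e a))
  have hpspan : Submodule.span F (Set.range fun a => p (e a)) = ⊤ := by
    have h1 : (Set.range fun a => p (e a)) = p '' Set.range e := (Set.range_comp p e)
    rw [h1, ← Submodule.map_span, he, Submodule.map_top, LinearMap.range_eq_top]
    exact ε.surjective.comp (Submodule.projectionOnto_surjective hW.symm)
  let R : Submodule (𝓞 F) F := LinearMap.range (Algebra.linearMap (𝓞 F) F)
  have hB'int : ∀ v ∈ Λ, ∀ w ∈ Λ, B' v w ∈ R := by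
    intro v hv w hw
    induction hv, hw using Submodule.span_induction₂ with
    | mem_mem x y hx hy =>
      obtain ⟨a, rfl⟩ := hx
      obtain ⟨b, rfl⟩ := hy
      obtain ⟨h, hh⟩ := hint a b
      exact ⟨h, by rw [hB'p]; exact hh⟩
    | zero_left y hy => simp
    | zero_right y hy => simp
    | add_left x y z _ _ _ h1 h2 =>
      rw [map_add, LinearMap.add_apply]
      exact R.add_mem h1 h2
    | add_right x y z _ _ _ h1 h2 =>
      rw [map_add]
      exact R.add_mem h1 h2
    | smul_left c x y _ _ h =>
      rw [algebra_compatible_smul F c x, map_smul, LinearMap.smul_apply,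
        ← algebra_compatible_smul]
      exact R.smul_mem c h
    | smul_right c x y _ _ h =>
      rw [algebra_compatible_smul F c y, map_smul, ← algebra_compatible_smul]
      exact R.smul_mem c h
  have hB'symm : ∀ v w, B' v w = B' w v := fun v w => hsymm _ _
  have hQint : ∀ v ∈ Λ, Q v ∈ R := by
    intro v hv
    induction hv using Submodule.span_induction with
    | mem x hx =>
      obtain ⟨a, rfl⟩ := hx
      refine ⟨q a, ?_⟩
      rw [hQ, hB'p, hq, inv_mul_cancel_left₀ two_ne_zero]
      rfl
    | zero => simp
    | add x y hx hy h1 h2 =>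
      have : Q (x + y) = Q x + Q y + B' x y := by
        simp only [hQ, map_add, LinearMap.add_apply, hB'symm y x]
        ring
      rw [this]
      exact R.add_mem (R.add_mem h1 h2) (hB'int x hx y hy)
    | smul c x _ h =>
      have : Q (c • x) = (c * c) • Q x := by
        rw [hQ, hQ, algebra_compatible_smul F c x, map_smul, map_smul, LinearMap.smul_apply,
          smul_eq_mul, smul_eq_mul, Algebra.smul_def, map_mul]
        ring
      rw [this]
      exact R.smul_mem _ h
  have hQpos : ∀ v, v ≠ 0 → TotallyPositive F (Q v) := by
    intro v hv φ
    have h1 : j v ≠ 0 := by simpa [j] using hv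
    have := hWpos (j v) (ε.symm v).2 h1 φ
    rw [hQ, hB', map_mul, map_inv₀, map_ofNat]
    positivity
  have hFG : Λ.FG := by
    obtain ⟨b, hb, hbspan, hbind⟩ := exists_linearIndependent F (Set.range fun a => p (e a))
    rw [hpspan] at hbspan
    have : Finite b := hbind.finite
    let T : (Fin (Module.finrank F W) → F) →ₗ[F] (b → F) :=
      LinearMap.pi fun y : b => B'.flip (y : Fin (Module.finrank F W) → F)
    have hT : Function.Injective T := by
      rw [injective_iff_map_eq_zero]
      intro v hv
      have h1 : ∀ w, B' v w = 0 := by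
        intro w
        have hw : w ∈ Submodule.span F b := hbspan ▸ Submodule.mem_top
        induction hw using Submodule.span_induction with
        | mem x hx => exact congrFun hv ⟨x, hx⟩
        | zero => simp
        | add x y _ _ h1 h2 => rw [map_add, h1, h2, add_zero]
        | smul c x _ h => rw [map_smul, h, smul_zero]
      by_contra hv0
      have := hQpos v hv0 φ₀
      simp [hQ, h1] at this
    let ι : (b → 𝓞 F) →ₗ[𝓞 F] (b → F) := (Algebra.linearMap (𝓞 F) F).compLeft b
    have hle : Λ.map (T.restrictScalars (𝓞 F)) ≤ LinearMap.range ι := by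
      rintro _ ⟨v, hv, rfl⟩
      have hmem : ∀ y : b, ∃ h : 𝓞 F, (h : F) = B' v y := by
        intro y
        obtain ⟨a, ha⟩ := hb y.2
        have hy : (y : Fin (Module.finrank F W) → F) ∈ Λ := Submodule.subset_span ⟨a, ha⟩
        exact hB'int v hv y hy
      choose h hh using hmem
      exact ⟨h, funext hh⟩
    refine Submodule.fg_of_fg_map_injective (T.restrictScalars (𝓞 F)) hT ?_
    have hN : IsNoetherian (𝓞 F) (LinearMap.range ι) := inferInstance
    exact isNoetherian_submodule.mp hN _ hle
  refine ⟨Module.finrank F W, Module.finrank_lt_of_rank_lt hrank, Λ, Q,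
    ⟨hFG, ?_, hQint, hQpos⟩, ?_⟩
  · rw [eq_top_iff, ← hpspan, Submodule.span_le]
    rintro _ ⟨a, rfl⟩
    exact Submodule.subset_span (Submodule.subset_span ⟨a, rfl⟩)
  · intro a
    refine ⟨p (e a), Submodule.subset_span ⟨a, rfl⟩, ?_⟩
    rw [hQ, hB'p, hq, inv_mul_cancel_left₀ two_ne_zero]

/-- The bilinear form on finitely supported functions with a given Gram matrix. -/
noncomputable def gramBilin {I F : Type*} [Field F] (h : I → I → F) :
    (I →₀ F) →ₗ[F] (I →₀ F) →ₗ[F] F :=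
  Finsupp.linearCombination F fun a => Finsupp.linearCombination F (h a)

theorem gramBilin_apply {I F : Type*} [Field F] (h : I → I → F) (x y : I →₀ F) :
    gramBilin h x y = ∑ a ∈ x.support, ∑ b ∈ y.support, x a * (y b * h a b) := by
  simp [gramBilin, Finsupp.linearCombination_apply, Finsupp.sum, LinearMap.sum_apply,
    Finset.mul_sum]

theorem gramBilin_single {I F : Type*} [Field F] (h : I → I → F) (a b : I) :
    gramBilin h (Finsupp.single a 1) (Finsupp.single b 1) = h a b := by
  simp [gramBilin]

theorem gramBilin_congr {I F : Type*} [Field F] {h h' : I → I → F} {S : Finset I}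
    (hS : ∀ a ∈ S, ∀ b ∈ S, h a b = h' a b) {x y : I →₀ F} (hx : x.support ⊆ S)
    (hy : y.support ⊆ S) : gramBilin h x y = gramBilin h' x y := by
  rw [gramBilin_apply, gramBilin_apply]
  exact Finset.sum_congr rfl fun a ha => Finset.sum_congr rfl fun b hb => by
    rw [hS a (hx ha) b (hy hb)]

theorem gramBilin_comm {I F : Type*} [Field F] {h : I → I → F} (hs : ∀ a b, h a b = h b a)
    (x y : I →₀ F) : gramBilin h x y = gramBilin h y x := by
  rw [gramBilin_apply, gramBilin_apply, Finset.sum_comm]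
  exact Finset.sum_congr rfl fun a ha => Finset.sum_congr rfl fun b hb => by
    rw [hs b a]
    ring

theorem algebraMap_gramBilin {F E I : Type*} [Field F] [Field E] [Algebra F E] {S : Finset I}
    {r : ℕ} (Q : QuadraticForm E (Fin r → E)) (v : I → Fin r → E) (h : I → I → F)
    (hh : ∀ a ∈ S, ∀ b ∈ S, algebraMap F E (h a b) = QuadraticMap.polar Q (v a) (v b))
    {x y : I →₀ F} (hx : x.support ⊆ S) (hy : y.support ⊆ S) :
    algebraMap F E (gramBilin h x y) =
      QuadraticMap.polarBilin Q (Finsupp.linearCombination F v x)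
        (Finsupp.linearCombination F v y) := by
  have hu : ∀ x : I →₀ F, Finsupp.linearCombination F v x =
      ∑ a ∈ x.support, algebraMap F E (x a) • v a := fun x => by
    rw [Finsupp.linearCombination_apply, Finsupp.sum]
    exact Finset.sum_congr rfl fun a _ => algebra_compatible_smul E _ _
  rw [hu, hu, gramBilin_apply, map_sum, map_sum (QuadraticMap.polarBilin Q), LinearMap.sum_apply]
  refine Finset.sum_congr rfl fun a ha => ?_
  rw [map_sum, map_sum]
  refine Finset.sum_congr rfl fun b hb => ?_
  rw [map_smul, map_smul, LinearMap.smul_apply, smul_eq_mul, smul_eq_mul, map_mul, map_mul,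
    hh a (hx ha) b (hy hb), QuadraticMap.polarBilin_apply_apply]
  ring

theorem gramBilin_radical_or_totallyPositive {F E I : Type*} [Field F] [Field E] [Algebra F E]
    (hext : ∀ φ : F →+* ℝ, ∃ ψ : E →+* ℝ, ψ.comp (algebraMap F E) = φ) {S : Finset I}
    {r : ℕ} (Q : QuadraticForm E (Fin r → E)) (hQ : ∀ w, w ≠ 0 → TotallyPositive E (Q w))
    (v : I → Fin r → E) (h : I → I → F)
    (hh : ∀ a ∈ S, ∀ b ∈ S, algebraMap F E (h a b) = QuadraticMap.polar Q (v a) (v b))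
    {x : I →₀ F} (hx : x.support ⊆ S) :
    (∀ y : I →₀ F, y.support ⊆ S → gramBilin h x y = 0) ∨
      TotallyPositive F (gramBilin h x x) := by
  by_cases h0 : Finsupp.linearCombination F v x = 0
  · left
    intro y hy
    apply (algebraMap F E).injective
    rw [algebraMap_gramBilin Q v h hh hx hy, h0]
    simp
  · right
    intro φ
    obtain ⟨ψ, rfl⟩ := hext φ
    have := hQ _ h0 ψ
    rw [RingHom.comp_apply, algebraMap_gramBilin Q v h hh hx hx,
      QuadraticMap.polarBilin_apply_apply, QuadraticMap.polar_self,
      two_smul, map_add]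
    exact add_pos this this

theorem exists_gramBilin_eq_zero {F E I : Type*} [Field F] [Field E] [Algebra F E]
    {S : Finset I} {r m : ℕ} (hr : r < m) (Q : QuadraticForm E (Fin r → E))
    (v : I → Fin r → E) (h : I → I → F)
    (hh : ∀ a ∈ S, ∀ b ∈ S, algebraMap F E (h a b) = QuadraticMap.polar Q (v a) (v b))
    (x : Fin m → I →₀ F) (hx : ∀ i, (x i).support ⊆ S) :
    ∃ c : Fin m → F, c ≠ 0 ∧ gramBilin h (∑ i, c i • x i) (∑ i, c i • x i) = 0 := by
  classical
  let M : Matrix (Fin m) (Fin m) F := fun i j => gramBilin h (x i) (x j)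
  let u : (Fin m → E) →ₗ[E] (Fin r → E) :=
    Fintype.linearCombination E fun j => Finsupp.linearCombination F v (x j)
  obtain ⟨d, hd, hd0⟩ := Submodule.exists_mem_ne_zero_of_ne_bot
    (LinearMap.ker_ne_bot_of_finrank_lt (f := u) (by simpa using hr))
  have hdet : (M.map (algebraMap F E)).det = 0 := by
    rw [← Matrix.exists_mulVec_eq_zero_iff]
    refine ⟨d, hd0, funext fun i => ?_⟩
    have h1 : ∑ j, d j • Finsupp.linearCombination F v (x j) = 0 := hd
    have h2 := congrArg (QuadraticMap.polarBilin Q (Finsupp.linearCombination F v (x i))) h1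
    rw [map_sum, map_zero] at h2
    change ∑ j, algebraMap F E (M i j) * d j = 0
    refine Eq.trans (Finset.sum_congr rfl fun j _ => ?_) h2
    rw [map_smul, smul_eq_mul, mul_comm, ← algebraMap_gramBilin Q v h hh (hx _) (hx _)]
  have hdet' : M.det = 0 := by
    apply (algebraMap F E).injective
    rw [RingHom.map_det, map_zero]
    exact hdet
  obtain ⟨c, hc0, hc⟩ := Matrix.exists_mulVec_eq_zero_iff.mpr hdet'
  refine ⟨c, hc0, ?_⟩
  simp only [map_sum, LinearMap.sum_apply, map_smul, LinearMap.smul_apply, smul_eq_mul,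
    Finset.mul_sum]
  rw [Finset.sum_comm]
  refine Finset.sum_eq_zero fun i _ => ?_
  have h1 : ∑ j, gramBilin h (x i) (x j) * c j = 0 := congrFun hc i
  calc ∑ j, c j * (c i * gramBilin h (x i) (x j))
      = c i * ∑ j, gramBilin h (x i) (x j) * c j := by
        rw [Finset.mul_sum]
        exact Finset.sum_congr rfl fun j _ => by ring
    _ = 0 := by rw [h1, mul_zero]

/-- Compactness: if all finite sets of totally positive integers admit compatible Gram matrices of
rank less than `m`, then there is a universal lattice of rank less than `m`. -/
theorem exists_isUniversalLattice_of_gram {F : Type*} [Field F] [NumberField F]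
    (hF : IsTotallyRealField F) (m : ℕ)
    (H : ∀ S : Finset {a : 𝓞 F // TotallyPositive F (a : F)},
      ∃ h : {a : 𝓞 F // TotallyPositive F (a : F)} → {a : 𝓞 F // TotallyPositive F (a : F)} → 𝓞 F,
        (∀ a ∈ S, ∀ b ∈ S, ∀ φ : F →+* ℝ, |φ (h a b)| ≤ φ (a.1 : F) + φ (b.1 : F)) ∧
        (∀ a ∈ S, ∀ b ∈ S, h a b = h b a) ∧ (∀ a ∈ S, h a a = 2 * a.1) ∧
        (∀ x : _ →₀ F, x.support ⊆ S →
          (∀ y : _ →₀ F, y.support ⊆ S → gramBilin (fun a b => (h a b : F)) x y = 0) ∨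
            TotallyPositive F (gramBilin (fun a b => (h a b : F)) x x)) ∧
        (∀ x : Fin m → _ →₀ F, (∀ i, (x i).support ⊆ S) → ∃ c : Fin m → F, c ≠ 0 ∧
          gramBilin (fun a b => (h a b : F)) (∑ i, c i • x i) (∑ i, c i • x i) = 0)) :
    ∃ r < m, ∃ Λ Q, IsUniversalLattice F r Λ Q := by
  classical
  have hne := hF.nonempty_ringHom_real
  let I := {a : 𝓞 F // TotallyPositive F (a : F)}
  let β : I × I → Type _ := fun p =>
    {y : 𝓞 F // ∀ φ : F →+* ℝ, |φ y| ≤ φ (p.1.1 : F) + φ (p.2.1 : F)}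
  have : ∀ p, Finite (β p) := fun p => by
    have hfin := finite_ringHom_real F
    obtain ⟨C, hC⟩ := (Set.finite_range fun φ : F →+* ℝ =>
      φ (p.1.1 : F) + φ (p.2.1 : F)).bddAbove
    exact ((hF.finite_abs_le C).subset fun y hy φ => (hy φ).trans (hC ⟨φ, rfl⟩)).to_subtype
  choose h hbound hsymm hdiag hpos hdet using H
  let zero : ∀ p, β p := fun p => ⟨0, fun φ => by
    have := p.1.2 φ
    have := p.2.2 φ
    simp only [map_zero, abs_zero]
    linarith⟩
  let S' : Finset (I × I) → Finset I := fun s => s.image Prod.fst ∪ s.image Prod.snd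
  let g : Finset (I × I) → ∀ p, β p := fun s p =>
    if hp : p.1 ∈ S' s ∧ p.2 ∈ S' s then
      ⟨h (S' s) p.1 p.2, hbound (S' s) p.1 hp.1 p.2 hp.2⟩ else zero p
  obtain ⟨χ, hχ⟩ := Finset.rado_selection g
  let k : I → I → 𝓞 F := fun a b => (χ (a, b)).1
  have hk : ∀ S : Finset I, ∃ T : Finset I, S ⊆ T ∧ ∀ a ∈ S, ∀ b ∈ S, k a b = h T a b := by
    intro S
    obtain ⟨t, hst, ht⟩ := hχ (S ×ˢ S)
    have hST : S ⊆ S' t := fun a ha =>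
      Finset.mem_union_left _ (Finset.mem_image_of_mem Prod.fst
        (hst (Finset.mk_mem_product ha ha)))
    refine ⟨S' t, hST, fun a ha b hb => ?_⟩
    simp only [k, ht (a, b) (Finset.mk_mem_product ha hb), g]
    rw [dif_pos ⟨hST ha, hST hb⟩]
  have hksymm : ∀ a b, k a b = k b a := fun a b => by
    obtain ⟨T, hT, hkT⟩ := hk {a, b}
    rw [hkT a (by simp) b (by simp), hkT b (by simp) a (by simp)]
    exact hsymm T a (hT (by simp)) b (hT (by simp))
  have hkdiag : ∀ a, k a a = 2 * a.1 := fun a => by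
    obtain ⟨T, hT, hkT⟩ := hk {a}
    rw [hkT a (by simp) a (by simp)]
    exact hdiag T a (hT (by simp))
  have hcongr : ∀ S T : Finset I, (∀ a ∈ S, ∀ b ∈ S, k a b = h T a b) →
      ∀ x y : I →₀ F, x.support ⊆ S → y.support ⊆ S →
        gramBilin (fun a b => (k a b : F)) x y = gramBilin (fun a b => (h T a b : F)) x y :=
    fun S T hkT x y hx hy => gramBilin_congr (fun a ha b hb => by rw [hkT a ha b hb]) hx hy
  obtain ⟨r, hr, Λ, Q, hΛ, hrep⟩ := exists_isTotPosLattice_of_bilin m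
    (fun a : I => Finsupp.single a (1 : F))
    (by simpa using (Finsupp.basisSingleOne (R := F) (ι := I)).span_eq)
    (gramBilin fun a b => (k a b : F))
    (gramBilin_comm fun a b => by rw [hksymm])
    (fun a b => ⟨k a b, (gramBilin_single (fun a b => (k a b : F)) a b).symm⟩) (fun a => a.1)
    (fun a => by
      rw [gramBilin_single, hkdiag]
      exact (map_mul (algebraMap (𝓞 F) F) _ _).trans (by rw [map_ofNat]))
    (fun x => by
      by_contra! hcon
      obtain ⟨⟨y, hy⟩, hx⟩ := hcon
      obtain ⟨T, hT, hkT⟩ := hk (x.support ∪ y.support)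
      have hxS := Finset.subset_union_left (s₁ := x.support) (s₂ := y.support)
      have hyS := Finset.subset_union_right (s₁ := x.support) (s₂ := y.support)
      rw [hcongr _ T hkT x y hxS hyS] at hy
      rw [hcongr _ T hkT x x hxS hxS] at hx
      rcases hpos T x (hxS.trans hT) with h1 | h1
      · exact hy (h1 y (hyS.trans hT))
      · exact hx h1)
    (fun x => by
      obtain ⟨T, hT, hkT⟩ := hk (Finset.univ.biUnion fun i => (x i).support)
      have hxS : ∀ i, (x i).support ⊆ Finset.univ.biUnion fun i => (x i).support :=
        fun i => Finset.subset_biUnion_of_mem (fun i => (x i).support) (Finset.mem_univ i)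
      obtain ⟨c, hc0, hc⟩ := hdet T x fun i => (hxS i).trans hT
      refine ⟨c, hc0, ?_⟩
      have hz : (∑ i, c i • x i).support ⊆ Finset.univ.biUnion fun i => (x i).support :=
        Finsupp.support_finsetSum.trans (Finset.biUnion_mono fun i _ => Finsupp.support_smul)
      rw [hcongr _ T hkT _ _ hz hz]
      exact hc)
  exact ⟨r, hr, Λ, Q, hΛ, fun a ha => hrep ⟨a, ha⟩⟩

open Polynomial in
/-- Algebraic integers of bounded degree all of whose conjugates are bounded have finitely many
conjugates altogether. -/
theorem NumberField.exists_finite_conjugates (n : ℕ) (B : ℝ) : ∃ T : Set ℂ, T.Finite ∧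
    ∀ (E : Type) [Field E] [NumberField E], Module.finrank ℚ E = n →
      ∀ x : 𝓞 E, (∀ φ : E →+* ℂ, ‖φ x‖ ≤ B) → ∀ φ : E →+* ℂ, φ x ∈ T := by
  classical
  let C := Nat.ceil (max B 1 ^ n * n.choose (n / 2))
  refine ⟨_, bUnion_roots_finite (algebraMap ℤ ℂ) n (Set.finite_Icc (-C : ℤ) C), ?_⟩
  rintro E _ _ rfl x hx φ
  simp_rw [Set.mem_iUnion]
  have hint : IsIntegral ℤ (x : E) := x.isIntegral_coe
  have hmin := minpoly.isIntegrallyClosed_eq_field_fractions' ℚ hint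
  refine ⟨minpoly ℤ (x : E), ⟨?_, fun i => ?_⟩, ?_⟩
  · rw [← (minpoly.monic hint).natDegree_map (algebraMap ℤ ℚ), ← hmin]
    exact minpoly.natDegree_le _
  · rw [Set.mem_Icc, ← abs_le, ← @Int.cast_le ℝ]
    refine (Eq.trans_le ?_ <| NumberField.Embeddings.coeff_bdd_of_norm_le hx i).trans
      (Nat.le_ceil _)
    rw [hmin, coeff_map, eq_intCast, Int.norm_cast_rat, Int.norm_eq_abs, Int.cast_abs]
  · refine mem_rootSet.2 ⟨minpoly.ne_zero hint, ?_⟩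
    have h1 : aeval (φ x) (minpoly ℤ (x : E)) = φ (aeval (x : E) (minpoly ℤ (x : E))) := by
      rw [aeval_def, aeval_def, hom_eval₂]
      congr 1
      exact RingHom.ext_int _ _
    rw [h1, minpoly.aeval, map_zero]

/-- The coordinates of an element are determined by its conjugates. -/
theorem Module.Basis.algebraMap_repr_eq_inv_mulVec {K E ι : Type*} [Field K] [CharZero K] [Field E]
    [Algebra K E] [FiniteDimensional K E] [Algebra K ℂ] [Fintype ι] [DecidableEq ι]
    (b : Module.Basis ι K E) (x : E) : ∃ τ : ι → (E →ₐ[K] ℂ), ∀ i,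
      algebraMap K ℂ (b.repr x i) =
        ((Matrix.of fun j i => τ j (b i))⁻¹.mulVec fun j => τ j x) i := by
  have hcard : Fintype.card ι = Fintype.card (E →ₐ[K] ℂ) := by
    rw [AlgHom.card, Module.finrank_eq_card_basis b]
  let e : ι ≃ (E →ₐ[K] ℂ) := Fintype.equivOfCardEq hcard
  refine ⟨e, fun i => ?_⟩
  set M : Matrix ι ι ℂ := Matrix.of fun j i => e j (b i) with hM
  have hdet : IsUnit M.det := by
    have h1 : M = (Algebra.embeddingsMatrixReindex K ℂ b e).transpose := by
      ext i j
      simp [hM, Algebra.embeddingsMatrixReindex, Algebra.embeddingsMatrix]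
    have h2 := Algebra.discr_eq_det_embeddingsMatrixReindex_pow_two K ℂ b e
    have h3 := Algebra.discr_not_zero_of_basis K b
    rw [isUnit_iff_ne_zero, h1, Matrix.det_transpose]
    intro h0
    rw [h0, zero_pow two_ne_zero, map_eq_zero] at h2
    exact h3 h2
  have h4 : (fun j => e j x) = M.mulVec fun i => algebraMap K ℂ (b.repr x i) := by
    ext j
    conv_lhs => rw [← b.sum_repr x]
    simp [Matrix.mulVec, dotProduct, hM, Algebra.smul_def, mul_comm]
  rw [h4, Matrix.mulVec_mulVec, Matrix.nonsing_inv_mul _ hdet, Matrix.one_mulVec]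

/-- Primitive number fields of large discriminant have only rational elements in a given finite
set. -/
theorem NumberField.exists_forall_discr_gt_imp_rat {U : Set ℂ} (hU : U.Finite) :
    ∃ C : ℝ, ∀ (K : IntermediateField ℚ ℝ) [NumberField K],
      C < (NumberField.discr K : ℝ) →
      (∀ M : IntermediateField ℚ ℝ, M ≤ K → M = ⊥ ∨ M = K) →
      ∀ c : K, (((c : ℝ) : ℂ)) ∈ U → ∃ q : ℚ, (c : ℝ) = q := by
  classical
  let f : IntermediateField ℚ ℝ → ℝ := fun M =>
    if h : NumberField M then (@NumberField.discr M _ h : ℝ) else 0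
  obtain ⟨C, hC⟩ := ((hU.image Complex.re).image
    fun x : ℝ => f (IntermediateField.adjoin ℚ {x})).bddAbove
  refine ⟨C, fun K hK hlt hprim c hc => ?_⟩
  rcases hprim (IntermediateField.adjoin ℚ {(c : ℝ)}) (by simp) with h | h
  · rw [IntermediateField.adjoin_simple_eq_bot_iff, IntermediateField.mem_bot] at h
    obtain ⟨q, hq⟩ := h
    exact ⟨q, by simpa using hq.symm⟩
  · have h1 := hC ⟨(c : ℝ), ⟨_, hc, Complex.ofReal_re _⟩, rfl⟩
    have h2 : f K = NumberField.discr K := dif_pos hK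
    change f _ ≤ C at h1
    rw [h, h2] at h1
    exact absurd hlt (not_lt.mpr h1)

theorem IsTotallyRealField.sup {K L : IntermediateField ℚ ℝ} (hK : IsTotallyRealField K)
    (hL : IsTotallyRealField L) : IsTotallyRealField ↥(K ⊔ L) := by
  intro φ x
  let M : IntermediateField ℚ ℝ := ((φ.eqLocusField ((starRingEnd ℂ).comp φ)).map
    (algebraMap ↥(K ⊔ L) ℝ)).toIntermediateField fun q => by
      refine ⟨algebraMap ℚ _ q, ?_, by simp⟩
      simp [RingHom.eqLocusField]
  have hM : K ⊔ L ≤ M := by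
    refine sup_le (fun y hy => ?_) (fun y hy => ?_)
    · refine ⟨⟨y, le_sup_left (a := K) hy⟩, ?_, rfl⟩
      have := hK (φ.comp (IntermediateField.inclusion (le_sup_left : K ≤ K ⊔ L)).toRingHom) ⟨y, hy⟩
      exact (Complex.conj_eq_iff_im.mpr this).symm
    · refine ⟨⟨y, le_sup_right (a := K) hy⟩, ?_, rfl⟩
      have := hL (φ.comp (IntermediateField.inclusion (le_sup_right : L ≤ K ⊔ L)).toRingHom) ⟨y, hy⟩
      exact (Complex.conj_eq_iff_im.mpr this).symm
  obtain ⟨y, hy, hyx⟩ := hM x.2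
  obtain rfl : y = x := Subtype.ext hyx
  exact Complex.conj_eq_iff_im.mp (Eq.symm hy)

theorem IsTotallyRealField.exists_comp_algebraMap_eq {F E : Type*} [Field F] [Field E]
    [Algebra F E] [Algebra.IsAlgebraic F E] (hE : IsTotallyRealField E) (φ : F →+* ℝ) :
    ∃ ψ : E →+* ℝ, ψ.comp (algebraMap F E) = φ := by
  let : Algebra F ℂ := (Complex.ofRealHom.comp φ).toAlgebra
  let χ : E →ₐ[F] ℂ := IsAlgClosed.lift
  obtain ⟨ψ, hψ⟩ := hE.exists_real χ
  refine ⟨ψ, RingHom.ext fun x => Complex.ofReal_injective ?_⟩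
  rw [RingHom.comp_apply, ← hψ]
  exact χ.commutes x

/-- The compositum of linearly disjoint fields has the expected basis. -/
theorem IntermediateField.LinearDisjoint.exists_basis_sup {K L : IntermediateField ℚ ℝ}
    [FiniteDimensional ℚ K] [FiniteDimensional ℚ L] (h : K.LinearDisjoint L) {ι : Type*}
    [Fintype ι] (ω : Module.Basis ι ℚ L) :
    letI := (IntermediateField.inclusion (le_sup_left : K ≤ K ⊔ L)).toRingHom.toAlgebra
    ∃ b : Module.Basis ι K ↥(K ⊔ L), ∀ i, ((b i : ↥(K ⊔ L)) : ℝ) = ω i := by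
  let : Algebra K ↥(K ⊔ L) :=
    (IntermediateField.inclusion (le_sup_left : K ≤ K ⊔ L)).toRingHom.toAlgebra
  have hst : IsScalarTower ℚ K ↥(K ⊔ L) := .of_algebraMap_eq fun _ => rfl
  let b : ι → ↥(K ⊔ L) := fun i => IntermediateField.inclusion le_sup_right (ω i)
  have hli : LinearIndependent K b := by
    have h1 := h.linearIndependent_right ω.linearIndependent
    let f : ↥(K ⊔ L) →ₗ[K] ℝ :=
      { toFun := fun x => x
        map_add' := fun _ _ => rfl
        map_smul' := fun c x => by
          rw [Algebra.smul_def]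
          rfl }
    exact LinearIndependent.of_comp f h1
  have hfin : FiniteDimensional ℚ ↥(K ⊔ L) := IntermediateField.finiteDimensional_sup K L
  have hfin' : FiniteDimensional K ↥(K ⊔ L) := FiniteDimensional.right ℚ K _
  have : Module.Free K ↥(K ⊔ L) := .of_divisionRing K _
  have hcard : Fintype.card ι = Module.finrank K ↥(K ⊔ L) := by
    have h1 := h.finrank_sup
    rw [← Module.finrank_mul_finrank ℚ K ↥(K ⊔ L), Module.finrank_eq_card_basis ω] at h1
    exact (Nat.eq_of_mul_eq_mul_left Module.finrank_pos h1).symm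
  have : Nonempty ι := Fintype.card_pos_iff.mp (hcard ▸ Module.finrank_pos)
  refine ⟨basisOfLinearIndependentOfCardEqFinrank hli hcard, fun i => ?_⟩
  simp [b]

/-- Integers of bounded size in the compositum with a primitive field of large discriminant come
from the base field. -/
theorem NumberField.exists_forall_discr_gt_imp_mem (k : ℕ) (L : IntermediateField ℚ ℝ)
    [NumberField L] (hL : IsTotallyRealField L) (B : ℝ) :
    ∃ C : ℝ, ∀ (K : IntermediateField ℚ ℝ) [NumberField K],
      IsTotallyRealField K →
      Module.finrank ℚ K = k →
      C < (NumberField.discr K : ℝ) →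
      IsCoprime (NumberField.discr K) (NumberField.discr L) →
      (∀ M : IntermediateField ℚ ℝ, M ≤ K → M = ⊥ ∨ M = K) →
      ∀ x : 𝓞 ↥(K ⊔ L), (∀ φ : ↥(K ⊔ L) →+* ℝ, |φ x| ≤ B) →
        ∃ y : 𝓞 L, ((y : L) : ℝ) = ((x : ↥(K ⊔ L)) : ℝ) := by
  classical
  have hfL : FiniteDimensional ℚ L := by convert! NumberField.to_finiteDimensional (K := L)
  let ω := Module.finBasis ℚ L
  let n := Module.finrank ℚ L
  obtain ⟨T, hT, hTE⟩ := NumberField.exists_finite_conjugates (k * n) B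
  have hemb : Finite (L →+* ℂ) := inferInstance
  have hU : (Set.image (fun p : (Fin n → L →+* ℂ) × (Fin n → ℂ) × Fin n =>
      ((Matrix.of fun j i => p.1 j (ω i))⁻¹.mulVec p.2.1) p.2.2)
      (Set.univ ×ˢ ((Set.pi Set.univ fun _ => T) ×ˢ Set.univ))).Finite :=
    (Set.finite_univ.prod ((Set.Finite.pi fun _ => hT).prod Set.finite_univ)).image _
  obtain ⟨C, hC⟩ := NumberField.exists_forall_discr_gt_imp_rat hU
  refine ⟨C, fun K _ hK hKk hlt hcop hprim x hx => ?_⟩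
  have hfK : FiniteDimensional ℚ K := by convert! NumberField.to_finiteDimensional (K := K)
  have hdisj := NumberField.linearDisjoint_of_isCoprime_discr K L hcop
  have hE := hK.sup hL
  let : Algebra K ↥(K ⊔ L) :=
    (IntermediateField.inclusion (le_sup_left : K ≤ K ⊔ L)).toRingHom.toAlgebra
  have hst : IsScalarTower ℚ K ↥(K ⊔ L) := .of_algebraMap_eq fun _ => rfl
  have hfin : FiniteDimensional ℚ ↥(K ⊔ L) := IntermediateField.finiteDimensional_sup K L
  have hfin' : FiniteDimensional K ↥(K ⊔ L) := FiniteDimensional.right ℚ K _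
  have : NumberField ↥(K ⊔ L) := { to_finiteDimensional := by convert! hfin }
  obtain ⟨b, hb⟩ := hdisj.exists_basis_sup ω
  obtain ⟨τ, hτ⟩ := b.algebraMap_repr_eq_inv_mulVec (x : ↥(K ⊔ L))
  have hfinrank : Module.finrank ℚ ↥(K ⊔ L) = k * n := by
    rw [hdisj.finrank_sup, hKk]
  have hconj : ∀ φ : ↥(K ⊔ L) →+* ℂ, φ x ∈ T := by
    refine hTE ↥(K ⊔ L) (by convert! hfinrank) x fun φ => ?_
    obtain ⟨ψ, hψ⟩ := hE.exists_real φ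
    rw [hψ]
    simpa using hx ψ
  have hrat : ∀ i, ∃ q : ℚ, ((b.repr x i : K) : ℝ) = q := by
    intro i
    refine hC K hlt hprim _ ⟨⟨fun j => (τ j : ↥(K ⊔ L) →+* ℂ).comp
      (IntermediateField.inclusion (le_sup_right : L ≤ K ⊔ L)).toRingHom, fun j => τ j x, i⟩,
      ⟨Set.mem_univ _, fun j _ => hconj (τ j : ↥(K ⊔ L) →+* ℂ), Set.mem_univ _⟩, ?_⟩
    refine Eq.trans ?_ (hτ i).symm
    congr! 5 with j i
    exact congrArg (τ j) (Subtype.ext (hb i).symm)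
  choose q hq using hrat
  have hxL : ((∑ i, q i • ω i : L) : ℝ) = ((x : ↥(K ⊔ L)) : ℝ) := by
    conv_rhs => rw [← b.sum_repr x]
    have h1 : ∀ f : Fin n → ↥(K ⊔ L), ((∑ i, f i : ↥(K ⊔ L)) : ℝ) = ∑ i, (f i : ℝ) :=
      fun f => map_sum (K ⊔ L).val f _
    have h2 : ∀ f : Fin n → L, ((∑ i, f i : L) : ℝ) = ∑ i, (f i : ℝ) :=
      fun f => map_sum L.val f _
    rw [h1, h2]
    refine Finset.sum_congr rfl fun i _ => ?_
    have h3 : ((b.repr x i • b i : ↥(K ⊔ L)) : ℝ) = (b.repr x i : ℝ) * (b i : ℝ) := by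
      rw [Algebra.smul_def]
      rfl
    rw [h3, hq, hb, ← Rat.smul_def]
    rfl
  have hint : IsIntegral ℤ (∑ i, q i • ω i : L) := by
    have h1 : IsIntegral ℤ ((x : ↥(K ⊔ L)) : ℝ) :=
      x.isIntegral_coe.map ((K ⊔ L).val.toRingHom.toIntAlgHom)
    rw [← hxL] at h1
    exact (isIntegral_algHom_iff L.val.toRingHom.toIntAlgHom L.val.injective).mp h1
  exact ⟨⟨_, hint⟩, hxL⟩

theorem TotallyPositive.abs_polar_le {E : Type*} [Field E] {r : ℕ}
    {Q : QuadraticForm E (Fin r → E)} (hQ : ∀ w, w ≠ 0 → TotallyPositive E (Q w))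
    (φ : E →+* ℝ) (v w : Fin r → E) :
    |φ (QuadraticMap.polar Q v w)| ≤ φ (Q v) + φ (Q w) := by
  have hnonneg : ∀ u, 0 ≤ φ (Q u) := fun u => by
    rcases eq_or_ne u 0 with rfl | hu
    · simp
    · exact (hQ u hu φ).le
  have h1 := hnonneg (v + w)
  have h2 := hnonneg (v + -w)
  rw [QuadraticMap.map_add Q] at h1 h2
  rw [QuadraticMap.polar_neg_right, QuadraticMap.map_neg] at h2
  simp only [map_add, map_neg] at h1 h2
  rw [abs_le]
  constructor <;> linarith

theorem main_theorem (k ℓ : ℕ) (hk : 0 < k) (hℓ : 0 < ℓ)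
    (L : IntermediateField ℚ ℝ) [NumberField L] (hLtr : IsTotallyRealField L)
    (hLdeg : Module.finrank ℚ L = ℓ) :
    ∃ C : ℝ, ∀ (K : IntermediateField ℚ ℝ) [NumberField K],
      IsTotallyRealField K →
      Module.finrank ℚ K = k →
      C < (NumberField.discr K : ℝ) →
      IsCoprime (NumberField.discr K) (NumberField.discr L) →
      (∀ M : IntermediateField ℚ ℝ, M ≤ K → M = ⊥ ∨ M = K) →
      (¬ IsGalois ℚ K ∨ ¬ (k ∣ ℓ)) →
      minUnivRank ↥L ≤ minUnivRank ↥(K ⊔ L) := by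
  by_contra! hcon
  suffices H : ∃ r < minUnivRank ↥L, ∃ Λ Q, IsUniversalLattice L r Λ Q by
    obtain ⟨r, hr, hΛ⟩ := H
    exact absurd (Nat.sInf_le hΛ) (not_le.mpr hr)
  refine exists_isUniversalLattice_of_gram hLtr _ fun S => ?_
  have := finite_ringHom_real L
  obtain ⟨B, hB⟩ := ((S.finite_toSet.prod S.finite_toSet).prod
    (Set.finite_univ (α := L →+* ℝ)) |>.image fun p =>
      p.2 (p.1.1.1 : L) + p.2 (p.1.2.1 : L)).bddAbove
  obtain ⟨C, hC⟩ := NumberField.exists_forall_discr_gt_imp_mem k L hLtr B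
  obtain ⟨K, _, hK, hKk, hlt, hcop, hprim, -, hm⟩ := hcon C
  have hmem := hC K hK hKk hlt hcop hprim
  have hE := hK.sup hLtr
  have hfL : FiniteDimensional ℚ L := by convert! NumberField.to_finiteDimensional (K := L)
  have hfK : FiniteDimensional ℚ K := by convert! NumberField.to_finiteDimensional (K := K)
  have hfin : FiniteDimensional ℚ ↥(K ⊔ L) := IntermediateField.finiteDimensional_sup K L
  have : NumberField ↥(K ⊔ L) := { to_finiteDimensional := by convert! hfin }
  let : Algebra L ↥(K ⊔ L) :=
    (IntermediateField.inclusion (le_sup_right : L ≤ K ⊔ L)).toRingHom.toAlgebra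
  have hst : IsScalarTower ℚ L ↥(K ⊔ L) := .of_algebraMap_eq fun _ => rfl
  have : FiniteDimensional L ↥(K ⊔ L) := FiniteDimensional.right ℚ L _
  have : Algebra.IsAlgebraic L ↥(K ⊔ L) := Algebra.IsAlgebraic.of_finite L _
  have hext := hE.exists_comp_algebraMap_eq (F := L)
  obtain ⟨Λ, Q, ⟨-, -, hΛint, hQ⟩, huniv⟩ : ∃ Λ Q,
      IsUniversalLattice ↥(K ⊔ L) (minUnivRank ↥(K ⊔ L)) Λ Q :=
    Nat.sInf_mem (exists_isUniversalLattice _ hE)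
  have hrep : ∀ a : {a : 𝓞 L // TotallyPositive L (a : L)}, ∃ v ∈ Λ,
      Q v = algebraMap L ↥(K ⊔ L) a.1 := fun a =>
    huniv (NumberField.RingOfIntegers.mapRingHom (algebraMap L ↥(K ⊔ L)) a.1)
      fun φ => a.2 (φ.comp (algebraMap L ↥(K ⊔ L)))
  choose v hvΛ hv using hrep
  have hpolar : ∀ a b, ∃ x : 𝓞 ↥(K ⊔ L), (x : ↥(K ⊔ L)) = QuadraticMap.polar Q (v a) (v b) := by
    intro a b
    obtain ⟨x, hx⟩ := hΛint _ (Λ.add_mem (hvΛ a) (hvΛ b))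
    obtain ⟨y, hy⟩ := hΛint _ (hvΛ a)
    obtain ⟨z, hz⟩ := hΛint _ (hvΛ b)
    refine ⟨x - y - z, ?_⟩
    rw [QuadraticMap.polar, ← hx, ← hy, ← hz]
    rfl
  have habs : ∀ a b, ∀ ψ : ↥(K ⊔ L) →+* ℝ, |ψ (QuadraticMap.polar Q (v a) (v b))| ≤
      ψ (algebraMap L ↥(K ⊔ L) a.1) + ψ (algebraMap L ↥(K ⊔ L) b.1) := fun a b ψ => by
    rw [← hv, ← hv]
    exact TotallyPositive.abs_polar_le hQ ψ _ _
  have hgram : ∀ a b, ∃ y : 𝓞 L, a ∈ S → b ∈ S →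
      algebraMap L ↥(K ⊔ L) y = QuadraticMap.polar Q (v a) (v b) := by
    intro a b
    by_cases hab : a ∈ S ∧ b ∈ S
    · obtain ⟨x, hx⟩ := hpolar a b
      obtain ⟨y, hy⟩ := hmem x fun ψ => by
        rw [hx]
        exact (habs a b ψ).trans (hB ⟨((a, b), ψ.comp (algebraMap L ↥(K ⊔ L))),
          ⟨hab, Set.mem_univ _⟩, rfl⟩)
      exact ⟨y, fun _ _ => by rw [← hx]; exact Subtype.ext hy⟩
    · exact ⟨0, fun ha hb => absurd ⟨ha, hb⟩ hab⟩
  choose h hh using hgram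
  have hh' : ∀ a ∈ S, ∀ b ∈ S,
      algebraMap L ↥(K ⊔ L) (h a b) = QuadraticMap.polar Q (v a) (v b) :=
    fun a ha b hb => hh a b ha hb
  refine ⟨h, fun a ha b hb φ => ?_, fun a ha b hb => ?_, fun a ha => ?_, fun x hx => ?_,
    fun x hx => ?_⟩
  · obtain ⟨ψ, rfl⟩ := hext φ
    rw [RingHom.comp_apply, hh' a ha b hb]
    exact habs a b ψ
  · apply NumberField.RingOfIntegers.coe_injective
    apply (algebraMap L ↥(K ⊔ L)).injective
    rw [hh' a ha b hb, hh' b hb a ha, QuadraticMap.polar_comm]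
  · apply NumberField.RingOfIntegers.coe_injective
    apply (algebraMap L ↥(K ⊔ L)).injective
    rw [hh' a ha a ha, QuadraticMap.polar_self, hv, two_smul, two_mul, map_add, map_add]
  · exact gramBilin_radical_or_totallyPositive hext Q hQ v (fun a b => (h a b : L)) hh' hx
  · exact exists_gramBilin_eq_zero hm Q v (fun a b => (h a b : L)) hh' x hx
end

section
/- Let K and L be number fields of degrees k and ℓ over ℚ such that disc_K and disc_L are coprime. Then [KL : ℚ] = kℓ. If additionally (i) K has no subfields other than ℚ and K itself, and (ii) K/ℚ is not Galois or k does not divide ℓ, then every intermediate field ℚ ⊆ M ⊆ KL satisfies M ⊆ L or M ⊇ K. -/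
noncomputable local instance (priority := 100) numberFieldOfFiniteDimensional
    {K : Type*} [Field K] [CharZero K] [FiniteDimensional ℚ K] : NumberField K := ⟨⟩

/-- Two algebra homomorphisms into a Noetherian domain that agree modulo a prime `P` are equal if the
source is unramified at the preimage of `P`. -/
theorem AlgHom.eq_of_sub_mem_of_isUnramifiedAt {R A B : Type*} [CommRing R] [CommRing A]
    [CommRing B] [IsDomain B] [IsNoetherianRing B] [Algebra R A] [Algebra R B] (f g : A →ₐ[R] B)
    (P : Ideal B) [P.IsPrime] [Algebra.IsUnramifiedAt R (P.comap f)]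
    (h : ∀ x, f x - g x ∈ P) : f = g := by
  have hg : P.comap f = P.comap g := by
    ext x
    rw [Ideal.mem_comap, Ideal.mem_comap]
    exact ⟨fun hx ↦ by simpa using P.sub_mem hx (h x), fun hx ↦ by simpa using P.add_mem (h x) hx⟩
  let F := Localization.localAlgHom (P.comap f) P f rfl
  let G := Localization.localAlgHom (P.comap f) P g hg
  have key : F = G := by
    refine Algebra.FormallyUnramified.ext_of_iInf
      (I := IsLocalRing.maximalIdeal (Localization.AtPrime P))
      (Ideal.iInf_pow_eq_bot_of_isLocalRing _ (Ideal.IsPrime.ne_top inferInstance)) fun x ↦ ?_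
    refine RingHom.congr_fun (f := (Ideal.Quotient.mk _).comp F.toRingHom)
      (g := (Ideal.Quotient.mk _).comp G.toRingHom)
      (IsLocalization.ringHom_ext (P.comap f).primeCompl (RingHom.ext fun a ↦ ?_)) x
    simp only [AlgHom.toRingHom_eq_coe, RingHom.comp_apply, RingHom.coe_coe, F, G,
      Localization.localAlgHom_apply, Localization.localRingHom_to_map]
    rw [Ideal.Quotient.eq, ← map_sub, IsLocalization.AtPrime.to_map_mem_maximal_iff _ P]
    exact h a
  ext x
  apply IsLocalization.injective (Localization.AtPrime P) P.primeCompl_le_nonZeroDivisors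
  have := DFunLike.congr_fun key (algebraMap A _ x)
  simpa [F, G, Localization.localRingHom_to_map] using this

open scoped NumberField in
/-- A prime not dividing the discriminant of `K` does not divide that of its normal closure. -/
theorem NumberField.not_dvd_discr_of_isNormalClosure {K N : Type*} [Field K] [NumberField K]
    [Field N] [NumberField N] [IsGalois ℚ N] [IsNormalClosure ℚ K N] {p : ℤ} (hp : Prime p)
    (h : ¬ p ∣ discr K) : ¬ p ∣ discr N := by
  rw [not_dvd_discr_iff_forall_mem _ (𝓞 K) hp] at h
  rw [not_dvd_discr_iff_forall_liesOver _ (𝓞 N) hp]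
  intro P hP _
  have : (Ideal.span {p}).IsPrime := (Ideal.span_singleton_prime hp.ne_zero).2 hp
  have hinertia : P.inertia Gal(N/ℚ) = ⊥ := by
    refine (Subgroup.eq_bot_iff_forall _).2 fun σ hσ ↦ ?_
    have hcomp (f : K →ₐ[ℚ] N) : (σ : N →ₐ[ℚ] N).comp f = f := by
      let F := (RingOfIntegers.mapRingHom (f : K →+* N)).toIntAlgHom
      let G := (RingOfIntegers.mapRingHom ((σ : N →ₐ[ℚ] N).comp f : K →+* N)).toIntAlgHom
      have hpF : (p : 𝓞 K) ∈ P.comap F := by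
        rw [Ideal.mem_comap, map_intCast]
        exact (Ideal.liesOver_span_iff hP.ne_top hp).1 ‹_›
      have := h _ inferInstance hpF
      have hGF : F = G := F.eq_of_sub_mem_of_isUnramifiedAt G P fun x ↦ by
        rw [← neg_sub]
        exact P.neg_mem (hσ (F x))
      refine AlgHom.coe_ringHom_injective (IsFractionRing.ringHom_ext (A := 𝓞 K) fun x ↦ ?_)
      exact congr_arg (algebraMap (𝓞 N) N) (DFunLike.congr_fun hGF x).symm
    have htop : IntermediateField.normalClosure ℚ K N = ⊤ :=
      (Algebra.IsAlgebraic.isNormalClosure_iff.1 ‹_›).2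
    have hle : IntermediateField.normalClosure ℚ K N ≤
        IntermediateField.fixedField (Subgroup.zpowers σ) := by
      rw [normalClosure_le_iff]
      intro f
      rw [IntermediateField.le_iff_le, Subgroup.zpowers_le]
      rintro ⟨_, x, rfl⟩
      exact DFunLike.congr_fun (hcomp f) x
    rw [htop, IntermediateField.le_iff_le, IntermediateField.fixingSubgroup_top,
      Subgroup.zpowers_le] at hle
    exact hle
  have hcard := Ideal.card_inertia_eq_ramificationIdxIn (G := Gal(N/ℚ)) (Ideal.span {p}) P
  rw [hinertia, Subgroup.card_bot, Ideal.ramificationIdxIn_eq_ramificationIdx _ P Gal(N/ℚ)] at hcard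
  exact Ideal.ramificationIdx_eq_one_iff.1 hcard.symm

/-- If `A` is maximal, with `A` and `B` containing normal subgroups that generate the group, then a
subgroup containing `A ⊓ B` is contained in `A` or contains `B`, unless `A` is normal and its index
divides that of `B`. -/
theorem Subgroup.le_or_le_of_inf_le {G : Type*} [Group G] {P Q A B W : Subgroup G}
    [P.Normal] [Q.Normal] (hPQ : P ⊔ Q = ⊤) (hQA : Q ≤ A) (hPB : P ≤ B)
    (hA : ∀ H, A ≤ H → H = A ∨ H = ⊤) (hQ : A.Normal → A ≤ Q) (hW : A ⊓ B ≤ W)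
    (hindex : ¬ A.Normal ∨ ¬ A.index ∣ B.index) : W ≤ A ∨ B ≤ W := by
  have hdec (x : G) : ∃ y ∈ P, ∃ z ∈ Q, y * z = x :=
    mem_sup_of_normal_left.1 (hPQ ▸ mem_top x)
  have hAle : A ≤ (W ⊓ P) ⊔ Q := by
    intro x hx
    obtain ⟨y, hy, z, hz, rfl⟩ := hdec x
    have hyA : y ∈ A := (A.mul_mem_cancel_right (hQA hz)).1 hx
    exact mul_mem_sup ⟨hW ⟨hyA, hPB hy⟩, hy⟩ hz
  rcases hA (W ⊔ Q) (hAle.trans (sup_le_sup_right inf_le_left _)) with h | hWQ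
  · exact .inl (le_sup_left.trans h.le)
  refine .inr ?_
  rcases hA _ hAle with h | h
  · exfalso
    have hnormal : A.Normal := by
      refine ⟨fun x hx g ↦ ?_⟩
      rw [← h] at hx ⊢
      obtain ⟨w, hw, q, hq, rfl⟩ := mem_sup_of_normal_right.1 (hWQ ▸ mem_top g)
      obtain ⟨y, hy, z, hz, rfl⟩ := mem_sup_of_normal_right.1 hx
      have hconj : w * q * (y * z) * (w * q)⁻¹ =
          w * y * w⁻¹ * (w * (y⁻¹ * q * y * z * q⁻¹) * w⁻¹) := by group
      rw [hconj]
      have hyq : y⁻¹ * q * y ∈ Q := by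
        simpa using Normal.conj_mem (inferInstanceAs Q.Normal) q hq y⁻¹
      exact mul_mem_sup
        ⟨W.mul_mem (W.mul_mem hw hy.1) (W.inv_mem hw), Normal.conj_mem inferInstance y hy.2 w⟩
        (Normal.conj_mem inferInstance _ (Q.mul_mem (Q.mul_mem hyq hz) (Q.inv_mem hq)) w)
    have hAQ : A = Q := le_antisymm (hQ hnormal) hQA
    refine hindex.elim (· hnormal) (· ?_)
    have hWP : W ⊓ P ≤ Q := le_sup_left.trans (h.trans hAQ).le
    let f := QuotientGroup.mk' P
    have hB : B ≤ ((W ⊓ Q).map f).comap f := by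
      rw [comap_map_eq, QuotientGroup.ker_mk']
      intro x hx
      obtain ⟨y, hy, z, hz, rfl⟩ := hdec x
      have hzB : z ∈ B := (B.mul_mem_cancel_left (hPB hy)).1 hx
      rw [sup_comm]
      exact mul_mem_sup hy ⟨hW ⟨hQA hz, hzB⟩, hz⟩
    have hD : ((W ⊓ Q).map f).comap f ⊓ W = Q ⊓ W := by
      refine le_antisymm (le_inf ?_ inf_le_right) (le_inf ?_ inf_le_right)
      · rw [comap_map_eq, QuotientGroup.ker_mk', sup_comm]
        rintro x ⟨hx, hxW⟩
        obtain ⟨y, hy, z, hz, rfl⟩ := mem_sup_of_normal_left.1 hx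
        exact Q.mul_mem (hWP ⟨(W.mul_mem_cancel_right hz.1).1 hxW, hy⟩) hz.2
      · rw [inf_comm]
        exact le_comap_map _ _
    calc A.index = Q.relIndex W := by
          rw [hAQ, ← relIndex_sup_right, hWQ, relIndex_top_right]
      _ = ((W ⊓ Q).map f).relIndex (W.map f) := by
          rw [← relIndex_comap, ← inf_relIndex_right (comap _ _), hD, inf_relIndex_right]
      _ ∣ ((W ⊓ Q).map f).index := relIndex_dvd_index_of_le (map_mono inf_le_left)
      _ = (((W ⊓ Q).map f).comap f).index :=
          (index_comap_of_surjective _ (QuotientGroup.mk'_surjective P)).symm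
      _ ∣ B.index := index_dvd_of_le hB
  · have hPW : P ≤ W := by
      intro x hx
      obtain ⟨y, hy, z, hz, rfl⟩ := mem_sup_of_normal_right.1 (h ▸ mem_top x)
      have hzP : z ∈ P := (P.mul_mem_cancel_left hy.2).1 hx
      exact W.mul_mem hy.1 (hW ⟨hQA hz, hPB hzP⟩)
    intro x hx
    obtain ⟨y, hy, z, hz, rfl⟩ := hdec x
    have hzB : z ∈ B := (B.mul_mem_cancel_left (hPB hy)).1 hx
    exact W.mul_mem (hPW hy) (hW ⟨hQA hz, hzB⟩)

/-- Number fields of coprime discriminants have normal closures intersecting in `ℚ`. -/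
theorem IntermediateField.normalClosure_inf_normalClosure_eq_bot {Ω : Type*} [Field Ω]
    [CharZero Ω] [IsGalois ℚ Ω] (K L : IntermediateField ℚ Ω) [FiniteDimensional ℚ K]
    [FiniteDimensional ℚ L] (hcop : IsCoprime (NumberField.discr K) (NumberField.discr L)) :
    normalClosure ℚ K Ω ⊓ normalClosure ℚ L Ω = ⊥ := by
  set M := normalClosure ℚ K Ω ⊓ normalClosure ℚ L Ω
  have : Normal ℚ (normalClosure ℚ K Ω) := normalClosure.normal _ _ _
  have : IsGalois ℚ (normalClosure ℚ K Ω) := ⟨⟩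
  have : IsNormalClosure ℚ K (normalClosure ℚ K Ω) :=
    @isNormalClosure_normalClosure _ _ _ _ _ _ _ _ ⟨K.val⟩ _
  have : Normal ℚ (normalClosure ℚ L Ω) := normalClosure.normal _ _ _
  have : IsGalois ℚ (normalClosure ℚ L Ω) := ⟨⟩
  have : IsNormalClosure ℚ L (normalClosure ℚ L Ω) :=
    @isNormalClosure_normalClosure _ _ _ _ _ _ _ _ ⟨L.val⟩ _
  suffices hunit : IsUnit (NumberField.discr M) by
    rw [← finrank_eq_one_iff]
    by_contra h
    have := NumberField.abs_discr_gt_two (K := M)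
      (Nat.one_lt_iff_ne_zero_and_ne_one.2 ⟨Module.finrank_pos.ne', h⟩)
    have := Int.isUnit_iff_abs_eq.1 hunit
    lia
  rw [Int.isUnit_iff_natAbs_eq, Nat.eq_one_iff_not_exists_prime_dvd]
  intro p hp hdvd
  rw [← Int.natCast_dvd] at hdvd
  have hp' := Nat.prime_iff_prime_int.1 hp
  have hK : NumberField.discr M ∣ NumberField.discr (normalClosure ℚ K Ω) :=
    letI : Algebra M (normalClosure ℚ K Ω) := (inclusion inf_le_left).toAlgebra
    NumberField.discr_dvd_discr _ _
  have hL : NumberField.discr M ∣ NumberField.discr (normalClosure ℚ L Ω) :=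
    letI : Algebra M (normalClosure ℚ L Ω) := (inclusion inf_le_right).toAlgebra
    NumberField.discr_dvd_discr _ _
  refine hp'.not_isUnit (hcop.isUnit_of_dvd' ?_ ?_)
  · exact not_not.1 fun h ↦
      NumberField.not_dvd_discr_of_isNormalClosure hp' h (hdvd.trans hK)
  · exact not_not.1 fun h ↦
      NumberField.not_dvd_discr_of_isNormalClosure hp' h (hdvd.trans hL)

/-- The Galois correspondence for subgroups containing the fixing subgroup of a finite extension. -/
theorem IntermediateField.fixingSubgroup_fixedField_of_le {F E : Type*} [Field F] [Field E]
    [Algebra F E] [IsGalois F E] (K : IntermediateField F E) [FiniteDimensional F K]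
    {H : Subgroup Gal(E/F)} (h : K.fixingSubgroup ≤ H) : (fixedField H).fixingSubgroup = H :=
  InfiniteGalois.fixingSubgroup_fixedField ⟨H, Subgroup.isClosed_of_isOpen H
    (Subgroup.isOpen_mono h K.fixingSubgroup_isOpen)⟩

theorem IntermediateField.le_or_le_of_le_sup {F E : Type*} [Field F] [Field E] [Algebra F E]
    [IsGalois F E] {K L M : IntermediateField F E} [FiniteDimensional F K] [FiniteDimensional F L]
    (hinf : normalClosure F K E ⊓ normalClosure F L E = ⊥)
    (hK : ∀ M' : IntermediateField F E, M' ≤ K → M' = ⊥ ∨ M' = K)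
    (hindex : ¬ IsGalois F K ∨ ¬ Module.finrank F K ∣ Module.finrank F L) (hM : M ≤ K ⊔ L) :
    M ≤ L ∨ K ≤ M := by
  let NK := normalClosure F K E
  let NL := normalClosure F L E
  have : IsGalois F NK := ⟨⟩
  have : IsGalois F NL := ⟨⟩
  have := (InfiniteGalois.normal_iff_isGalois NK).2 inferInstance
  have := (InfiniteGalois.normal_iff_isGalois NL).2 inferInstance
  rw [finrank_eq_fixingSubgroup_index, finrank_eq_fixingSubgroup_index,
    ← InfiniteGalois.normal_iff_isGalois] at hindex
  refine (Subgroup.le_or_le_of_inf_le (P := NL.fixingSubgroup) (Q := NK.fixingSubgroup)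
    (W := M.fixingSubgroup) ?_ (fixingSubgroup_le (le_normalClosure K))
    (fixingSubgroup_le (le_normalClosure L)) ?_ ?_ ?_ hindex).symm.imp ?_ ?_
  · rw [← fixingSubgroup_fixedField_of_le NL (le_sup_left (b := NK.fixingSubgroup)),
      ← fixingSubgroup_bot]
    congr 1
    rw [eq_bot_iff, ← hinf, le_inf_iff]
    constructor
    · exact (fixedField_antitone le_sup_right).trans_eq
        (InfiniteGalois.fixedField_fixingSubgroup NK)
    · exact (fixedField_antitone le_sup_left).trans_eq
        (InfiniteGalois.fixedField_fixingSubgroup NL)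
  · intro H hH
    rw [← fixingSubgroup_fixedField_of_le K hH, ← fixingSubgroup_bot]
    have hle : fixedField H ≤ K := by
      rw [← InfiniteGalois.fixedField_fixingSubgroup K]
      exact fixedField_antitone hH
    exact (hK _ hle).symm.imp (congr_arg _) (congr_arg _)
  · intro hnormal
    have := (InfiniteGalois.normal_iff_isGalois K).1 hnormal
    exact fixingSubgroup_le (normalClosure_of_normal K).le
  · rw [← fixingSubgroup_sup]
    exact fixingSubgroup_le hM
  · rw [← le_iff_le, InfiniteGalois.fixedField_fixingSubgroup]
    exact id
  · rw [← le_iff_le, InfiniteGalois.fixedField_fixingSubgroup]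
    exact id

open IntermediateField in
theorem compositum_subfields (k ℓ : ℕ)
    (K L : IntermediateField ℚ (AlgebraicClosure ℚ))
    [FiniteDimensional ℚ K] [FiniteDimensional ℚ L]
    (hKdeg : Module.finrank ℚ K = k) (hLdeg : Module.finrank ℚ L = ℓ)
    (hcop : IsCoprime (NumberField.discr ↥K) (NumberField.discr ↥L)) :
    Module.finrank ℚ ↥(K ⊔ L) = k * ℓ ∧
      ((∀ M : IntermediateField ℚ (AlgebraicClosure ℚ), M ≤ K → M = ⊥ ∨ M = K) →
        (¬ IsGalois ℚ K ∨ ¬ (k ∣ ℓ)) →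
        ∀ M : IntermediateField ℚ (AlgebraicClosure ℚ), M ≤ K ⊔ L → (M ≤ L ∨ K ≤ M)) := by
  subst hKdeg hLdeg
  have : IsAlgClosure ℚ (AlgebraicClosure ℚ) := AlgebraicClosure.instIsAlgClosure ℚ
  have : IsGalois ℚ (AlgebraicClosure ℚ) := IsAlgClosure.isGalois _ _
  have hinf := normalClosure_inf_normalClosure_eq_bot K L hcop
  have : Normal ℚ (normalClosure ℚ K (AlgebraicClosure ℚ)) := normalClosure.normal _ _ _
  have : IsGalois ℚ (normalClosure ℚ K (AlgebraicClosure ℚ)) := ⟨⟩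
  exact ⟨((LinearDisjoint.of_inf_eq_bot hinf).of_le (le_normalClosure K)
    (le_normalClosure L)).finrank_sup, fun hK hindex M hM ↦ le_or_le_of_le_sup hinf hK hindex hM⟩
end
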